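/- arXiv:2007.10881 — 6 statements merged into one kernel-verified Lean document; each statement's English description precedes it below -/
import Mathlib

section
/- For all integers n ≥ 0, k ≥ 1, and for i = 1 or i = 2, the number P^{2k+1}_{2,i}(n) of partitions of n all of whose parts are at least 2k+1, with at most i-1 parts equal to 2k+1, in which every even part is at least 2(m+k) (where m is the total number of parts), and in which the odd parts listed in decreasing order satisfy λ_{j_ℓ} - λ_{j_{ℓ+2}} ≥ 4 for every valid ℓ, equals the number B^{2k+1}_{2,i}(n) of partitions of n all of whose parts are at least 2k+1, with at most i-1 parts equal to 2k+1, and in which any two parts differ by at least 2. -/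
/-!
Formalization of statements from "Even-Odd partition identities of
Rogers-Ramanujan type" (P. Afsharijoo).

A partition of `n` is modelled by Mathlib's `Nat.Partition n` (a multiset of
positive parts summing to `n`).  Sorted-in-increasing-order lists of parts are
used to express the conditions on consecutive parts of the decreasing
enumeration `λ_1 ≥ λ_2 ≥ …`.
-/

/-- The parts of a partition, sorted in increasing order. -/
def Nat.Partition.sortedParts {n : ℕ} (p : n.Partition) : List ℕ :=
  p.parts.sort (· ≤ ·)

/-- The odd parts of a partition, sorted in increasing order. -/
def Nat.Partition.oddParts {n : ℕ} (p : n.Partition) : List ℕ :=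
  (p.parts.filter (fun x => ¬ Even x)).sort (· ≤ ·)

/-- The even parts of a partition, sorted in increasing order. -/
def Nat.Partition.evenParts {n : ℕ} (p : n.Partition) : List ℕ :=
  (p.parts.filter (fun x => Even x)).sort (· ≤ ·)

/-- `GapCond L d g` : any two entries of `L` lying `d` positions apart differ by at
least `g`.  When `L` lists parts in increasing order, this says that the
corresponding decreasing enumeration `λ_1 ≥ λ_2 ≥ …` satisfies
`λ_ℓ - λ_{ℓ+d} ≥ g` for every valid index `ℓ`.
In particular `GapCond p.sortedParts 1 2` says that any two parts of `p`
differ by at least `2` (no equal and no consecutive parts), and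
`GapCond p.oddParts 2 4` says that the odd parts satisfy
`λ_{j_ℓ} - λ_{j_{ℓ+2}} ≥ 4`. -/
def GapCond (L : List ℕ) (d g : ℕ) : Prop :=
  ∀ ℓ : ℕ, ℓ + d < L.length → g ≤ L[ℓ + d]! - L[ℓ]!

/-- `Pbig2k1 k i n` = number of partitions of `n` (of any length `m`) with all
parts at least `2k+1`, at most `i - 1` parts equal to `2k+1`, every even part at
least `2(m+k)` where `m` is the number of parts, and odd parts (in decreasing
order) satisfying `λ_{j_ℓ} - λ_{j_{ℓ+2}} ≥ 4`. -/
noncomputable def Pbig2k1 (k i n : ℕ) : ℕ :=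
  Nat.card {p : n.Partition //
    (∀ x ∈ p.parts, 2 * k + 1 ≤ x) ∧
    Multiset.count (2 * k + 1) p.parts ≤ i - 1 ∧
    (∀ x ∈ p.parts, Even x → 2 * (Multiset.card p.parts + k) ≤ x) ∧
    GapCond p.oddParts 2 4}

/-- `Bbig2k1 k i n` = number of partitions of `n` with all parts at least `2k+1`,
at most `i - 1` parts equal to `2k+1`, and any two parts differing by at
least `2`. -/
noncomputable def Bbig2k1 (k i n : ℕ) : ℕ :=
  Nat.card {p : n.Partition //
    (∀ x ∈ p.parts, 2 * k + 1 ≤ x) ∧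
    Multiset.count (2 * k + 1) p.parts ≤ i - 1 ∧
    GapCond p.sortedParts 1 2}

open Cardinal in
theorem Cardinal.mk_eq_add_of_diff_eq_image {α β : Type} {A B : Set α} {C : Set β} (f : β → α)
    (hf : Function.Injective f) (hBA : B ⊆ A) (hC : ∀ t, f t ∈ A \ B ↔ t ∈ C)
    (hs : A \ B ⊆ Set.range f) : #A = #B + #C := by
  have h : A = B ∪ f '' C := by
    ext s
    constructor
    · intro hsA
      by_cases hsB : s ∈ B
      · exact Or.inl hsB
      · obtain ⟨t, rfl⟩ := hs ⟨hsA, hsB⟩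
        exact Or.inr ⟨t, (hC t).1 ⟨hsA, hsB⟩, rfl⟩
    · rintro (h | ⟨t, ht, rfl⟩)
      · exact hBA h
      · exact ((hC t).2 ht).1
  have hd : Disjoint B (f '' C) := by
    rw [Set.disjoint_right]
    rintro _ ⟨t, ht, rfl⟩
    exact ((hC t).2 ht).2
  rw [h, mk_union_of_disjoint hd, mk_image_eq hf]

namespace Multiset

theorem exists_eq_map_add {s : Multiset ℕ} {j : ℕ} (h : ∀ x ∈ s, j ≤ x) :
    ∃ t : Multiset ℕ, t.map (· + j) = s := by
  refine ⟨s.map (· - j), ?_⟩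
  rw [map_map]
  conv_rhs => rw [← map_id s]
  exact map_congr rfl fun x hx => Nat.sub_add_cancel (h x hx)

theorem sum_map_add_const (t : Multiset ℕ) (j : ℕ) :
    (t.map (· + j)).sum = t.sum + card t * j := by
  simp [sum_map_add]

theorem count_add_map_add (t : Multiset ℕ) (x j : ℕ) : count (x + j) (t.map (· + j)) = count x t :=
  count_map_eq_count' _ _ (add_left_injective j) x

theorem count_map_add_of_lt (t : Multiset ℕ) {x j : ℕ} (h : x < j) :
    count x (t.map (· + j)) = 0 := by
  rw [count_eq_zero, mem_map]
  rintro ⟨y, -, hy⟩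
  omega

theorem map_add_injective (j : ℕ) : Function.Injective (map (· + j) : Multiset ℕ → Multiset ℕ) :=
  map_injective (add_left_injective j)

theorem cons_map_add_injective (a j : ℕ) :
    Function.Injective (fun t : Multiset ℕ => a ::ₘ t.map (· + j)) := fun _ _ h =>
  map_add_injective j ((cons_inj_right a).1 h)

theorem countP_window_two (s : Multiset ℕ) (x : ℕ) :
    s.countP (fun y => x ≤ y ∧ y < x + 2) = count x s + count (x + 1) s := by
  induction s using Multiset.induction with
  | empty => simp
  | cons a s ih =>
    rw [countP_cons, count_cons, count_cons, ih]
    split_ifs <;> omega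

theorem countP_window_four_filter_odd (s : Multiset ℕ) (x : ℕ) :
    (s.filter (fun y => ¬ Even y)).countP (fun y => x ≤ y ∧ y < x + 4) =
      if Even x then count (x + 1) s + count (x + 3) s else count x s + count (x + 2) s := by
  rw [countP_filter]
  induction s using Multiset.induction with
  | empty => simp
  | cons a s ih =>
    rw [countP_cons, ih]
    simp only [count_cons, Nat.even_iff]
    split_ifs <;> omega

end Multiset

theorem gapCond_iff_countP {L : List ℕ} (hL : L.Pairwise (· ≤ ·)) {d g : ℕ} (hg : 0 < g) :
    GapCond L d g ↔ ∀ x, L.countP (fun y => x ≤ y ∧ y < x + g) ≤ d := by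
  have hmono : ∀ i j (hj : j < L.length) (hij : i ≤ j), L[i] ≤ L[j] := fun i j hj hij =>
    hL.sortedLE.getElem_le_getElem_of_le hij
  constructor
  · intro h x
    by_contra! hx
    rw [List.countP_eq_length_filter] at hx
    set F := L.filter (fun y => x ≤ y ∧ y < x + g) with hF
    have hFL : F.Sublist L := List.filter_sublist
    obtain ⟨f, hf⟩ := List.sublist_iff_exists_fin_orderEmbedding_get_eq.1 hFL
    have hmem : ∀ i : Fin F.length, x ≤ F.get i ∧ F.get i < x + g := fun i => by
      have := List.get_mem F i
      simp only [hF, List.mem_filter, decide_eq_true_eq] at this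
      exact this.2
    have hF0 : 0 < F.length := by omega
    have hstep : ∀ i (hi : i < F.length),
        (f ⟨0, hF0⟩ : ℕ) + i ≤ f ⟨i, hi⟩ := by
      intro i
      induction i with
      | zero => intro hi; simp
      | succ i ih =>
        intro hi
        have h1 := ih (by omega)
        have h2 : f ⟨i, by omega⟩ < f ⟨i + 1, hi⟩ := f.strictMono (by simp)
        have h3 : (f ⟨i, by omega⟩ : ℕ) < f ⟨i + 1, hi⟩ := h2
        omega
    have h1 := hstep d hx
    have h2 := (f ⟨d, hx⟩).2
    have h3 := h (f ⟨0, hF0⟩) (by omega)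
    rw [getElem!_pos L _ (by omega), getElem!_pos L _ (by omega)] at h3
    have h4 := hmono _ _ h2 h1
    have h5 := hmem ⟨d, hx⟩
    have h6 := hmem ⟨0, by omega⟩
    rw [hf] at h5 h6
    simp only [List.get_eq_getElem] at h5 h6
    omega
  · intro h l hl
    by_contra! hlt
    rw [getElem!_pos L _ hl, getElem!_pos L _ (by omega)] at hlt
    have hsub : ((L.drop l).take (d + 1)).Sublist L :=
      (List.take_sublist _ _).trans (List.drop_sublist _ _)
    have h1 := hsub.countP_le (p := fun y => decide (L[l] ≤ y ∧ y < L[l] + g))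
    have h2 := h L[l]
    rw [List.countP_eq_length.2, List.length_take, List.length_drop] at h1
    · omega
    · intro y hy
      obtain ⟨i, hi, rfl⟩ := List.mem_iff_getElem.1 hy
      simp only [List.length_take, List.length_drop] at hi
      simp only [List.getElem_take, List.getElem_drop, decide_eq_true_eq]
      have h3 := hmono l (l + i) (by omega) (by omega)
      have h4 := hmono (l + i) (l + d) (by omega) (by omega)
      omega

theorem Nat.Partition.gapCond_sortedParts {n : ℕ} (p : n.Partition) :
    GapCond p.sortedParts 1 2 ↔ ∀ x, p.parts.count x + p.parts.count (x + 1) ≤ 1 := by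
  rw [Nat.Partition.sortedParts, gapCond_iff_countP (Multiset.pairwise_sort _ _) (by norm_num)]
  refine forall_congr' fun x => ?_
  rw [← Multiset.countP_window_two, ← Multiset.coe_countP, Multiset.sort_eq]

theorem Nat.Partition.gapCond_oddParts {n : ℕ} (p : n.Partition) :
    GapCond p.oddParts 2 4 ↔ ∀ x, Odd x → p.parts.count x + p.parts.count (x + 2) ≤ 2 := by
  have h : GapCond p.oddParts 2 4 ↔ ∀ x, (if Even x then
      p.parts.count (x + 1) + p.parts.count (x + 3)
      else p.parts.count x + p.parts.count (x + 2)) ≤ 2 := by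
    rw [Nat.Partition.oddParts, gapCond_iff_countP (Multiset.pairwise_sort _ _) (by norm_num)]
    refine forall_congr' fun x => ?_
    rw [← Multiset.countP_window_four_filter_odd, ← Multiset.coe_countP, Multiset.sort_eq]
  rw [h]
  constructor
  · intro h x hx
    simpa [Nat.not_even_iff_odd.2 hx] using h x
  · intro h x
    split_ifs with hx
    · exact h (x + 1) hx.add_one
    · exact h x (Nat.not_even_iff_odd.1 hx)

/-- Multisets with `m` elements and sum `n` whose even elements are at least `2 * t`, with at most
`c` ones, and such that any two consecutive odd numbers occur at most twice in total. -/
def evenOddSets (c m t : ℕ) (n : ℤ) : Set (Multiset ℕ) :=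
  {s | s.card = m ∧ (s.sum : ℤ) = n ∧ (∀ x ∈ s, Even x → 2 * t ≤ x) ∧
    (∀ x, Odd x → s.count x + s.count (x + 2) ≤ 2) ∧ s.count 1 ≤ c}

/-- Multisets with `m` elements and sum `n`, all at least `c`, and such that any two consecutive
numbers occur at most once in total. -/
def gapSets (c m : ℕ) (n : ℤ) : Set (Multiset ℕ) :=
  {s | s.card = m ∧ (s.sum : ℤ) = n ∧ (∀ x, s.count x + s.count (x + 1) ≤ 1) ∧ ∀ x ∈ s, c ≤ x}

open Cardinal Multiset

theorem mk_gapSets_add (c j m : ℕ) (n : ℤ) :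
    #(gapSets (c + j) m n) = #(gapSets c m (n - j * m)) := by
  rw [Cardinal.mk_eq_add_of_diff_eq_image (A := gapSets (c + j) m n) (B := ∅)
    (C := gapSets c m (n - j * m)) (map (· + j)) (map_add_injective j) (Set.empty_subset _),
    mk_eq_zero, zero_add]
  · intro t
    simp only [gapSets, Set.sdiff_empty, Set.mem_ofPred_eq, card_map, sum_map_add_const]
    refine and_congr_right fun hm => and_congr ?_ (and_congr ?_ ?_)
    · subst hm; push_cast; constructor <;> intro h <;> linarith
    · constructor
      · intro h x
        have := h (x + j)
        rwa [add_right_comm, count_add_map_add, count_add_map_add] at this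
      · intro h x
        rcases lt_or_ge x j with hx | hx
        · rw [count_map_add_of_lt _ hx, zero_add]
          rcases lt_or_ge (x + 1) j with hx' | hx'
          · rw [count_map_add_of_lt _ hx']; omega
          · obtain ⟨y, hy⟩ := Nat.exists_eq_add_of_le' hx'
            rw [hy, count_add_map_add]
            have := h y
            omega
        · obtain ⟨y, rfl⟩ := Nat.exists_eq_add_of_le' hx
          rw [add_right_comm, count_add_map_add, count_add_map_add]
          exact h y
    · simp [mem_map]
  · rintro s ⟨⟨-, -, -, h⟩, -⟩
    exact exists_eq_map_add fun x hx => (Nat.le_add_left j c).trans (h x hx)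

theorem mk_gapSets_add_two (c m : ℕ) (n : ℤ) :
    #(gapSets (c + 2) m n) = #(gapSets c m (n - 2 * m)) := mk_gapSets_add c 2 m n

theorem mk_gapSets_succ (c m : ℕ) (n : ℤ) : #(gapSets c (m + 1) n) =
    #(gapSets (c + 1) (m + 1) n) + #(gapSets (c + 2) m (n - c)) := by
  refine Cardinal.mk_eq_add_of_diff_eq_image (c ::ₘ ·) (fun _ _ h => (cons_inj_right c).1 h) ?_ ?_ ?_
  · rintro s ⟨h1, h2, h3, h4⟩
    exact ⟨h1, h2, h3, fun x hx => (Nat.le_succ c).trans (h4 x hx)⟩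
  · intro t
    simp only [gapSets, Set.mem_sdiff, Set.mem_ofPred_eq, card_cons, sum_cons, mem_cons, count_cons]
    constructor
    · rintro ⟨⟨h1, h2, h3, h4⟩, -⟩
      refine ⟨by omega, by omega, fun x => ?_, fun x hx => ?_⟩
      · have := h3 x; omega
      · have h5 := h4 x (Or.inr hx)
        have h6 := h3 c
        simp only [if_true] at h6
        have h7 := count_pos.2 hx
        rcases Nat.lt_or_ge x (c + 2) with h | h
        · obtain rfl | rfl : x = c ∨ x = c + 1 := by omega
          · omega
          · omega
        · exact h
    · rintro ⟨h1, h2, h3, h4⟩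
      refine ⟨⟨by omega, by omega, fun x => ?_, ?_⟩, ?_⟩
      · have h5 : ∀ y, y < c + 2 → count y t = 0 := fun y hy =>
          count_eq_zero.2 fun h => by have := h4 y h; omega
        have h6 := h3 x
        by_cases h7 : x < c + 1
        · rw [h5 x (by omega), h5 (x + 1) (by omega)]
          split_ifs <;> omega
        · split_ifs <;> omega
      · rintro x (rfl | hx)
        · exact le_rfl
        · have := h4 x hx; omega
      · rintro ⟨-, -, -, h⟩
        have := h c (Or.inl rfl)
        omega
  · rintro s ⟨⟨h1, h2, h3, h4⟩, hs⟩
    by_cases hc : c ∈ s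
    · exact ⟨s.erase c, cons_erase hc⟩
    · refine absurd ⟨h1, h2, h3, fun x hx => ?_⟩ hs
      have h5 := h4 x hx
      have h6 : x ≠ c := fun h => hc (h ▸ hx)
      omega

theorem mk_evenOddSets_succ (c m t : ℕ) (n : ℤ) : #(evenOddSets c (m + 1) t n) =
    #(evenOddSets c (m + 1) (t + 1) n) + #(evenOddSets c m t (n - 2 * t)) := by
  refine Cardinal.mk_eq_add_of_diff_eq_image ((2 * t) ::ₘ ·)
    (fun _ _ h => (cons_inj_right _).1 h) ?_ ?_ ?_
  · rintro s ⟨h1, h2, h3, h4, h5⟩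
    exact ⟨h1, h2, fun x hx he => by have := h3 x hx he; omega, h4, h5⟩
  · intro s
    have hodd : ∀ x, Odd x → count x ((2 * t) ::ₘ s) = count x s := fun x hx =>
      count_cons_of_ne (by rintro rfl; exact absurd hx (by simp)) _
    simp only [evenOddSets, Set.mem_sdiff, Set.mem_ofPred_eq, card_cons, sum_cons, mem_cons]
    constructor
    · rintro ⟨⟨h1, h2, h3, h4, h5⟩, -⟩
      refine ⟨by omega, by omega, fun x hx => h3 x (Or.inr hx),
        fun x hx => ?_, ?_⟩
      · rw [← hodd x hx, ← hodd (x + 2) (by grind)]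
        exact h4 x hx
      · rwa [← hodd 1 odd_one]
    · rintro ⟨h1, h2, h3, h4, h5⟩
      refine ⟨⟨by omega, by omega, ?_, fun x hx => ?_, ?_⟩, ?_⟩
      · rintro x (rfl | hx) he
        · exact le_rfl
        · exact h3 x hx he
      · rw [hodd x hx, hodd (x + 2) (by grind)]
        exact h4 x hx
      · rwa [hodd 1 odd_one]
      · rintro ⟨-, -, h, -⟩
        have := h (2 * t) (Or.inl rfl) (by simp)
        omega
  · rintro s ⟨⟨h1, h2, h3, h4⟩, hs⟩
    by_cases hc : 2 * t ∈ s
    · exact ⟨s.erase (2 * t), cons_erase hc⟩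
    · refine absurd ⟨h1, h2, fun x hx he => ?_, h4⟩ hs
      have h5 := h3 x hx he
      have h6 : x ≠ 2 * t := fun h => hc (h ▸ hx)
      grind

/-- The elements of `evenOddSets` containing exactly `c` ones correspond, after removing these ones
and lowering all other elements by two, to elements of `evenOddSets` with at most `2 - c` ones. -/
theorem ones_add_map_mem_evenOddSets_iff {b c m t : ℕ} (hcb : c ≤ b) (hc : c ≤ 2) (n : ℤ)
    (s : Multiset ℕ) :
    replicate c 1 + s.map (· + 2) ∈ evenOddSets b (m + c) (t + 1) n ↔
      s ∈ evenOddSets (2 - c) m t (n - (2 * m + c)) := by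
  have h1 : count 1 (replicate c 1 + s.map (· + 2)) = c := by
    rw [count_add, count_map_add_of_lt s one_lt_two, count_replicate_self, add_zero]
  have h2 : ∀ x, count (x + 2) (replicate c 1 + s.map (· + 2)) = count x s := fun x => by
    rw [count_add, count_add_map_add, count_eq_zero.2, zero_add]
    intro h
    have := eq_of_mem_replicate h
    omega
  simp only [evenOddSets, Set.mem_ofPred_eq, h1, card_add, card_replicate, card_map, sum_add,
    sum_replicate, sum_map_add_const]
  constructor
  · rintro ⟨e1, e2, e3, e4, -⟩
    have hm : card s = m := by omega
    refine ⟨hm, by subst hm; simp only [smul_eq_mul, mul_one] at e2; omega,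
      fun x hx he => ?_, fun x hx => ?_, ?_⟩
    · have := e3 (x + 2) (mem_add.2 (Or.inr (mem_map_of_mem (· + 2) hx))) (by grind)
      omega
    · rw [← h2 x, ← h2 (x + 2)]
      exact e4 (x + 2) (by grind)
    · have := e4 1 odd_one
      rw [h1, h2 1] at this
      omega
  · rintro ⟨rfl, e2, e3, e4, e5⟩
    refine ⟨by omega, by simp only [smul_eq_mul, mul_one]; omega,
      fun x hx he => ?_, fun x hx => ?_, hcb⟩
    · rcases mem_add.1 hx with hx | hx
      · rw [eq_of_mem_replicate hx] at he
        exact absurd he (by decide)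
      · obtain ⟨y, hy, rfl⟩ := mem_map.1 hx
        have := e3 y hy (by grind)
        omega
    · obtain rfl | ⟨y, rfl⟩ : x = 1 ∨ ∃ y, x = y + 2 := by
        rcases x with _ | _ | y
        · exact absurd hx (by decide)
        · exact Or.inl rfl
        · exact Or.inr ⟨y, rfl⟩
      · rw [h1, h2 1]
        omega
      · rw [h2, h2]
        exact e4 y (by grind)

theorem exists_eq_ones_add_map {b m t : ℕ} {n : ℤ} {s : Multiset ℕ}
    (hs : s ∈ evenOddSets b m (t + 1) n) :
    ∃ u : Multiset ℕ, replicate (count 1 s) 1 + u.map (· + 2) = s := by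
  obtain ⟨u, hu⟩ := exists_eq_map_add (s := s.filter (fun x => ¬ 1 = x)) (j := 2) fun x hx => by
    obtain ⟨hx, h1⟩ := mem_filter.1 hx
    by_contra h
    have := hs.2.2.1 x hx (by interval_cases x <;> simp_all)
    omega
  refine ⟨u, ?_⟩
  rw [hu, ← filter_eq]
  exact filter_add_not _ s

theorem ones_add_map_injective (c : ℕ) :
    Function.Injective (fun u : Multiset ℕ => replicate c 1 + u.map (· + 2)) := fun _ _ h =>
  map_add_injective 2 (add_left_cancel h)

theorem mk_evenOddSets_zero (m t : ℕ) (n : ℤ) :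
    #(evenOddSets 0 m (t + 1) n) = #(evenOddSets 2 m t (n - 2 * m)) := by
  rw [Cardinal.mk_eq_add_of_diff_eq_image (A := evenOddSets 0 m (t + 1) n) (B := ∅)
    (C := evenOddSets 2 m t (n - 2 * m)) _ (ones_add_map_injective 0) (Set.empty_subset _),
    mk_eq_zero, zero_add]
  · intro s
    rw [Set.sdiff_empty]
    simpa using ones_add_map_mem_evenOddSets_iff (b := 0) (m := m) (t := t) le_rfl zero_le_two n s
  · rintro s ⟨hs, -⟩
    obtain ⟨u, hu⟩ := exists_eq_ones_add_map hs
    rw [Nat.le_zero.1 hs.2.2.2.2] at hu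
    exact ⟨u, hu⟩

theorem mk_evenOddSets_succ_ones (c m t : ℕ) (hc : c ≤ 1) (n : ℤ) :
    #(evenOddSets (c + 1) (m + (c + 1)) (t + 1) n) = #(evenOddSets c (m + (c + 1)) (t + 1) n) +
      #(evenOddSets (2 - (c + 1)) m t (n - (2 * m + (c + 1)))) := by
  refine Cardinal.mk_eq_add_of_diff_eq_image _ (ones_add_map_injective (c + 1)) ?_ ?_ ?_
  · rintro s ⟨h1, h2, h3, h4, h5⟩
    exact ⟨h1, h2, h3, h4, h5.trans c.le_succ⟩
  · intro s
    have h := ones_add_map_mem_evenOddSets_iff (b := c + 1) (m := m) (t := t) le_rfl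
      (show c + 1 ≤ 2 by omega) n s
    rw [Nat.cast_succ] at h
    rw [Set.mem_sdiff, h, and_iff_left]
    rintro ⟨-, -, -, -, h⟩
    rw [count_add, count_replicate_self] at h
    omega
  · rintro s ⟨hs, hs'⟩
    obtain ⟨u, hu⟩ := exists_eq_ones_add_map hs
    have h1 : count 1 s = c + 1 := by
      by_contra h
      have := hs.2.2.2.2
      exact hs' ⟨hs.1, hs.2.1, hs.2.2.1, hs.2.2.2.1, by omega⟩
    rw [h1] at hu
    exact ⟨u, hu⟩

theorem mk_evenOddSets_two_succ (m : ℕ) (n : ℤ) : #(evenOddSets 2 (m + 1) m n) =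
    #(evenOddSets 1 (m + 1) (m + 1) n) + #(evenOddSets 2 m (m - 1) (n - 2 * m)) := by
  rw [mk_evenOddSets_succ 2 m m]
  rcases m with _ | m
  · congr 3
    ext s
    simp only [evenOddSets, Set.mem_ofPred_eq]
    refine and_congr_right fun h => ?_
    have := count_le_card 1 s
    simp [show count 1 s ≤ 1 by omega, show count 1 s ≤ 2 by omega]
  · have h1 := mk_evenOddSets_succ_ones 1 m (m + 1) le_rfl n
    rw [show m + (1 + 1) = m + 1 + 1 by ring] at h1
    rw [h1, show 2 - (1 + 1) = 0 by rfl, mk_evenOddSets_zero, add_tsub_cancel_right,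
      mk_evenOddSets_succ 2 m m, add_assoc, add_comm #(evenOddSets 2 m m _)]
    push_cast
    ring_nf

theorem mk_evenOddSets_eq_mk_gapSets (m : ℕ) (n : ℤ) :
    #(evenOddSets 2 m (m - 1) n) = #(gapSets 0 m n) ∧
      #(evenOddSets 1 m m n) = #(gapSets 1 m n) := by
  induction m generalizing n with
  | zero =>
    constructor <;> congr 3 <;> ext s <;>
      simp only [evenOddSets, gapSets, Set.mem_ofPred_eq, card_eq_zero] <;>
      refine and_congr_right ?_ <;> rintro rfl <;> simp
  | succ m ih =>
    have key : ∀ N : ℕ, ∀ n : ℤ, n < N →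
        #(evenOddSets 2 (m + 1) m n) = #(gapSets 0 (m + 1) n) ∧
          #(evenOddSets 1 (m + 1) (m + 1) n) = #(gapSets 1 (m + 1) n) := by
      intro N
      induction N with
      | zero =>
        intro n hn
        have h1 : ∀ c t, evenOddSets c (m + 1) t n = ∅ := fun c t =>
          Set.eq_empty_of_forall_notMem fun s hs => by have := hs.2.1; omega
        have h2 : ∀ c, gapSets c (m + 1) n = ∅ := fun c =>
          Set.eq_empty_of_forall_notMem fun s hs => by have := hs.2.1; omega
        simp only [h1, h2, and_self]
      | succ N ihN =>
        intro n hn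
        have hb : #(evenOddSets 1 (m + 1) (m + 1) n) = #(gapSets 1 (m + 1) n) := by
          have h1 := mk_evenOddSets_succ_ones 0 m m zero_le_one n
          simp only [zero_add, Nat.add_one_sub_one, Nat.cast_zero] at h1
          rw [h1, mk_evenOddSets_zero, (ihN _ (by push_cast at hn ⊢; linarith)).1, (ih _).2,
            mk_gapSets_succ 1, mk_gapSets_add_two 0, mk_gapSets_add_two 1]
          push_cast
          ring_nf
        refine ⟨?_, hb⟩
        rw [mk_evenOddSets_two_succ, hb, (ih _).1, mk_gapSets_succ 0, mk_gapSets_add_two 0,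
          Nat.cast_zero, sub_zero]
    exact key (n.toNat + 1) n (by push_cast; have := n.self_le_toNat; linarith)

theorem mk_evenOddSets_self {i : ℕ} (hi : i = 1 ∨ i = 2) (m : ℕ) (n : ℤ) :
    #(evenOddSets (i - 1) m m n) = #(gapSets (3 - i) m n) := by
  rcases hi with rfl | rfl
  · rcases m with _ | m
    · congr 3
      ext s
      simp only [evenOddSets, gapSets, Set.mem_ofPred_eq, card_eq_zero]
      refine and_congr_right ?_
      rintro rfl
      simp
    · have h1 := mk_evenOddSets_zero (m + 1) m n
      have h2 := mk_gapSets_add_two 0 (m + 1) n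
      exact h1.trans ((mk_evenOddSets_eq_mk_gapSets (m + 1) _).1.trans h2.symm)
  · exact (mk_evenOddSets_eq_mk_gapSets m n).2

/-- Partitions of `n` into `m` parts exceeding `j`, in terms of the parts lowered by `j`. -/
theorem Nat.Partition.mk_subtype_eq_mk_lowered {n m j : ℕ} {Q : Multiset ℕ → Prop}
    {A : Set (Multiset ℕ)} (hQ : ∀ s, Q s → ∀ x ∈ s, j + 1 ≤ x)
    (hA : ∀ t, t ∈ A ↔ card t = m ∧ (t.sum : ℤ) = n - j * m ∧ Q (t.map (· + j))) :
    #{p : {p : n.Partition // Q p.parts} // card p.1.parts = m} = #A := by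
  refine (mk_congr (Equiv.ofBijective (fun t : A =>
    (⟨⟨⟨t.1.map (· + j), fun {x} hx => ?_, ?_⟩, ((hA t).1 t.2).2.2⟩, ?_⟩ :
      {p : {p : n.Partition // Q p.parts} // card p.1.parts = m})) ⟨?_, ?_⟩)).symm
  · exact (Nat.succ_pos j).trans_le (hQ _ ((hA t).1 t.2).2.2 x hx)
  · obtain ⟨h1, h2, -⟩ := (hA t).1 t.2
    rw [sum_map_add_const, h1, ← Nat.cast_inj (R := ℤ), Nat.cast_add, Nat.cast_mul, h2]
    ring
  · simpa using ((hA t).1 t.2).1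
  · intro t u h
    simp only [Subtype.mk.injEq, Nat.Partition.mk.injEq] at h
    exact Subtype.ext (map_add_injective j h)
  · rintro ⟨⟨p, hp⟩, hm⟩
    obtain ⟨t, ht⟩ := exists_eq_map_add (j := j) fun x hx => (Nat.le_succ j).trans (hQ _ hp x hx)
    refine ⟨⟨t, (hA t).2 ?_⟩, ?_⟩
    · have hc : card t = m := by rw [← hm, ← ht, card_map]
      refine ⟨hc, ?_, ht ▸ hp⟩
      have := p.parts_sum
      rw [← ht, sum_map_add_const, hc, ← Nat.cast_inj (R := ℤ), Nat.cast_add, Nat.cast_mul] at this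
      linarith
    · simp only [Subtype.mk.injEq]
      exact Nat.Partition.ext ht

theorem mem_evenOddSets_iff_map_add (k c m n : ℕ) (t : Multiset ℕ) :
    t ∈ evenOddSets c m m (n - (2 * k : ℕ) * m) ↔
      card t = m ∧ (t.sum : ℤ) = n - (2 * k : ℕ) * m ∧
        (∀ x ∈ t.map (· + 2 * k), 2 * k + 1 ≤ x) ∧
        count (2 * k + 1) (t.map (· + 2 * k)) ≤ c ∧
        (∀ x ∈ t.map (· + 2 * k), Even x → 2 * (card (t.map (· + 2 * k)) + k) ≤ x) ∧
        ∀ x, Odd x → count x (t.map (· + 2 * k)) + count (x + 2) (t.map (· + 2 * k)) ≤ 2 := by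
  rw [evenOddSets, Set.mem_ofPred_eq]
  refine and_congr_right fun hm => and_congr_right fun _ => ?_
  rw [add_comm (2 * k) 1, count_add_map_add, card_map, hm]
  constructor
  · rintro ⟨h3, h4, h5⟩
    refine ⟨fun x hx => ?_, h5, fun x hx he => ?_, fun x hx => ?_⟩
    · obtain ⟨y, hy, rfl⟩ := mem_map.1 hx
      have : 0 < card t := card_pos_iff_exists_mem.2 ⟨y, hy⟩
      rcases y with _ | y
      · have := h3 0 hy (by simp)
        omega
      · omega
    · obtain ⟨y, hy, rfl⟩ := mem_map.1 hx
      have := h3 y hy (by grind)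
      omega
    · rcases lt_or_ge x (2 * k) with h | h
      · rw [count_map_add_of_lt _ h]
        have h6 := h4 1 odd_one
        rcases lt_or_ge (x + 2) (2 * k) with h' | h'
        · rw [count_map_add_of_lt _ h']
          omega
        · rw [show x + 2 = 1 + 2 * k by grind, count_add_map_add]
          omega
      · obtain ⟨y, rfl⟩ := Nat.exists_eq_add_of_le' h
        rw [add_right_comm, count_add_map_add, count_add_map_add]
        exact h4 y (by grind)
  · rintro ⟨-, h5, h3, h4⟩
    refine ⟨fun x hx he => ?_, fun x hx => ?_, h5⟩
    · have := h3 _ (mem_map_of_mem _ hx) (by grind)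
      omega
    · have := h4 (x + 2 * k) (by grind)
      rwa [add_right_comm, count_add_map_add, count_add_map_add] at this

theorem mem_gapSets_iff_map_add {i : ℕ} (hi : i = 1 ∨ i = 2) (k m n : ℕ) (t : Multiset ℕ) :
    t ∈ gapSets (3 - i) m (n - (2 * k : ℕ) * m) ↔
      card t = m ∧ (t.sum : ℤ) = n - (2 * k : ℕ) * m ∧
        (∀ x ∈ t.map (· + 2 * k), 2 * k + 1 ≤ x) ∧
        count (2 * k + 1) (t.map (· + 2 * k)) ≤ i - 1 ∧
        ∀ x, count x (t.map (· + 2 * k)) + count (x + 1) (t.map (· + 2 * k)) ≤ 1 := by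
  rw [gapSets, Set.mem_ofPred_eq]
  refine and_congr_right fun hm => and_congr_right fun _ => ?_
  rw [add_comm (2 * k) 1, count_add_map_add]
  constructor
  · rintro ⟨h3, h4⟩
    have h0 : count 0 t = 0 := count_eq_zero.2 fun h => by have := h4 0 h; omega
    refine ⟨fun x hx => ?_, ?_, fun x => ?_⟩
    · obtain ⟨y, hy, rfl⟩ := mem_map.1 hx
      have := h4 y hy
      omega
    · rcases hi with rfl | rfl
      · rw [count_eq_zero.2 fun h => by have := h4 1 h; omega]
      · have := h3 1
        omega
    · rcases lt_or_ge x (2 * k) with h | h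
      · rw [count_map_add_of_lt _ h, zero_add]
        rcases lt_or_ge (x + 1) (2 * k) with h' | h'
        · rw [count_map_add_of_lt _ h']
          omega
        · rw [show x + 1 = 0 + 2 * k by omega, count_add_map_add]
          omega
      · obtain ⟨y, rfl⟩ := Nat.exists_eq_add_of_le' h
        rw [add_right_comm, count_add_map_add, count_add_map_add]
        exact h3 y
  · rintro ⟨h1, h5, h4⟩
    refine ⟨fun x => ?_, fun x hx => ?_⟩
    · have := h4 (x + 2 * k)
      rwa [add_right_comm, count_add_map_add, count_add_map_add] at this
    · have h6 := h1 _ (mem_map_of_mem _ hx)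
      have h7 : x = 1 → i ≠ 1 := by
        rintro rfl rfl
        have := count_pos.2 hx
        omega
      omega

/-- For all `n ≥ 0`, `k ≥ 1` and `i = 1` or `2`,
`P^{2k+1}_{2,i}(n) = B^{2k+1}_{2,i}(n)`. -/
theorem Pbig2k1_eq_Bbig2k1 (n k i : ℕ) (hk : 1 ≤ k) (hi : i = 1 ∨ i = 2) :
    Pbig2k1 k i n = Bbig2k1 k i n := by
  classical
  unfold Pbig2k1 Bbig2k1
  simp only [Nat.Partition.gapCond_oddParts, Nat.Partition.gapCond_sortedParts]
  rw [← Nat.card_congr (Equiv.sigmaFiberEquiv fun p : {p : n.Partition // _} => card p.1.parts),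
    ← Nat.card_congr (Equiv.sigmaFiberEquiv fun p : {p : n.Partition // _} => card p.1.parts)]
  refine Nat.card_congr (Equiv.sigmaCongrRight fun m => Classical.choice (Cardinal.eq.1 ?_))
  rw [Nat.Partition.mk_subtype_eq_mk_lowered (j := 2 * k) (Q := fun s : Multiset ℕ =>
      (∀ x ∈ s, 2 * k + 1 ≤ x) ∧ count (2 * k + 1) s ≤ i - 1 ∧
        (∀ x ∈ s, Even x → 2 * (card s + k) ≤ x) ∧ ∀ x, Odd x → count x s + count (x + 2) s ≤ 2)
      (fun s h => h.1) (mem_evenOddSets_iff_map_add k (i - 1) m n),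
    Nat.Partition.mk_subtype_eq_mk_lowered (j := 2 * k) (Q := fun s : Multiset ℕ =>
      (∀ x ∈ s, 2 * k + 1 ≤ x) ∧ count (2 * k + 1) s ≤ i - 1 ∧
        ∀ x, count x s + count (x + 1) s ≤ 1)
      (fun s h => h.1) (mem_gapSets_iff_map_add hi k m n)]
  exact mk_evenOddSets_self hi m _
end

section
/- For all integers k ≥ 1, m ≥ 0, n ≥ 2mk, and for i = 1 or i = 2, p^{2k+1}_{2,i}(m,n) = p_{2,i}(m, n - 2mk), where p^{2k+1}_{2,i}(m,n) counts partitions of n with exactly m parts, all parts at least 2k+1, at most i-1 parts equal to 2k+1, every even part at least 2(m+k), and odd parts (in decreasing order) satisfying λ_{j_ℓ} - λ_{j_{ℓ+2}} ≥ 4, and p_{2,i}(m,n') counts partitions of n' with exactly m parts, at most i-1 parts equal to 1, every even part at least 2m, and odd parts (in decreasing order) satisfying λ_{j_ℓ} - λ_{j_{ℓ+2}} ≥ 4. -/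
/-- `p2k1 k i m n` = number of partitions of `n` with exactly `m` parts, all parts
at least `2k+1`, at most `i - 1` parts equal to `2k+1`, every even part at least
`2(m+k)`, and odd parts (in decreasing order) satisfying
`λ_{j_ℓ} - λ_{j_{ℓ+2}} ≥ 4`. -/
noncomputable def p2k1 (k i m n : ℕ) : ℕ :=
  Nat.card {p : n.Partition //
    Multiset.card p.parts = m ∧
    (∀ x ∈ p.parts, 2 * k + 1 ≤ x) ∧
    Multiset.count (2 * k + 1) p.parts ≤ i - 1 ∧
    (∀ x ∈ p.parts, Even x → 2 * (m + k) ≤ x) ∧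
    GapCond p.oddParts 2 4}

/-- `p2 i m n` = number of partitions of `n` with exactly `m` parts, at most
`i - 1` parts equal to `1`, every even part at least `2m`, and odd parts (in
decreasing order) satisfying `λ_{j_ℓ} - λ_{j_{ℓ+2}} ≥ 4`. -/
noncomputable def p2 (i m n : ℕ) : ℕ :=
  Nat.card {p : n.Partition //
    Multiset.card p.parts = m ∧
    Multiset.count 1 p.parts ≤ i - 1 ∧
    (∀ x ∈ p.parts, Even x → 2 * m ≤ x) ∧
    GapCond p.oddParts 2 4}

namespace Nat.Partition

/-- The partition obtained by adding `c` to every part of `p`. -/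
def shiftParts {n N : ℕ} (p : n.Partition) (c : ℕ)
    (h : n + Multiset.card p.parts * c = N) : N.Partition where
  parts := p.parts.map (· + c)
  parts_pos := by
    intro x hx
    obtain ⟨y, hy, rfl⟩ := Multiset.mem_map.1 hx
    exact Nat.add_pos_left (p.parts_pos hy) c
  parts_sum := by
    rw [Multiset.sum_map_add, Multiset.map_id', p.parts_sum, Multiset.map_const',
      Multiset.sum_replicate, smul_eq_mul, h]

@[simp]
theorem parts_shiftParts {n N : ℕ} (p : n.Partition) (c : ℕ)
    (h : n + Multiset.card p.parts * c = N) :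
    (p.shiftParts c h).parts = p.parts.map (· + c) :=
  rfl

theorem oddParts_shiftParts {n N : ℕ} (p : n.Partition) {c : ℕ} (hc : Even c)
    (h : n + Multiset.card p.parts * c = N) :
    (p.shiftParts c h).oddParts = p.oddParts.map (· + c) := by
  have hodd : ((fun x => ¬ Even x) ∘ (· + c)) = fun x : ℕ => ¬ Even x := by
    ext x
    simp [Nat.odd_add, hc]
  unfold oddParts
  rw [parts_shiftParts, Multiset.filter_map, Multiset.map_sort (r := (· ≤ ·)) (r' := (· ≤ ·))]
  · simp only [hodd]
  · simp

/-- A partition with all parts larger than `c` arises by adding `c` to every part of another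
partition. -/
theorem exists_map_add_eq {n N : ℕ} (p : N.Partition) (c : ℕ) (hp : ∀ x ∈ p.parts, c + 1 ≤ x)
    (h : n + Multiset.card p.parts * c = N) :
    ∃ q : n.Partition, q.parts.map (· + c) = p.parts := by
  have hmap : (p.parts.map (· - c)).map (· + c) = p.parts := by
    rw [Multiset.map_map]
    conv_rhs => rw [← Multiset.map_id p.parts]
    refine Multiset.map_congr rfl fun x hx => ?_
    have := hp x hx
    simp only [Function.comp_apply, id_eq]
    omega
  refine ⟨⟨p.parts.map (· - c), ?_, ?_⟩, hmap⟩
  · intro x hx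
    obtain ⟨y, hy, rfl⟩ := Multiset.mem_map.1 hx
    have := hp y hy
    omega
  · have hsum := congrArg Multiset.sum hmap
    rw [Multiset.sum_map_add, Multiset.map_id', p.parts_sum, Multiset.map_const',
      Multiset.sum_replicate, Multiset.card_map, smul_eq_mul] at hsum
    omega

end Nat.Partition

theorem gapCond_map_add (L : List ℕ) (c d g : ℕ) :
    GapCond (L.map (· + c)) d g ↔ GapCond L d g := by
  unfold GapCond
  rw [List.length_map]
  refine forall₂_congr fun l hl => ?_
  have hl' : l < L.length := by omega
  simp [hl, hl', Nat.add_sub_add_right]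

/-- For all `k ≥ 1`, `m ≥ 0`, `n ≥ 2mk` and `i = 1` or `2`,
`p^{2k+1}_{2,i}(m,n) = p_{2,i}(m, n - 2mk)`. -/
theorem p2k1_eq_p2_shift (k m n i : ℕ) (hk : 1 ≤ k) (hn : 2 * m * k ≤ n)
    (hi : i = 1 ∨ i = 2) :
    p2k1 k i m n = p2 i m (n - 2 * m * k) := by
  have hmul : m * (2 * k) = 2 * m * k := by ring
  have hshift {q : (n - 2 * m * k).Partition} (hq : Multiset.card q.parts = m) :
      n - 2 * m * k + Multiset.card q.parts * (2 * k) = n := by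
    rw [hq, hmul]
    omega
  have hcount (s : Multiset ℕ) :
      Multiset.count (2 * k + 1) (s.map (· + 2 * k)) = Multiset.count 1 s := by
    rw [Nat.add_comm (2 * k) 1]
    exact Multiset.count_map_eq_count' _ s (add_left_injective (2 * k)) 1
  unfold p2k1 p2
  symm
  refine Nat.card_eq_of_bijective (fun q => ⟨q.1.shiftParts (2 * k) (hshift q.2.1), ?_⟩) ⟨?_, ?_⟩
  · obtain ⟨q, hcard, hone, heven, hgap⟩ := q
    refine ⟨by simpa using hcard, ?_, by simpa [hcount] using hone, ?_, ?_⟩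
    · intro x hx
      obtain ⟨y, hy, rfl⟩ := Multiset.mem_map.1 hx
      have := q.parts_pos hy
      omega
    · intro x hx hxe
      obtain ⟨y, hy, rfl⟩ := Multiset.mem_map.1 hx
      have := heven y hy (by simpa [Nat.even_add] using hxe)
      omega
    · rwa [Nat.Partition.oddParts_shiftParts _ (even_two_mul k), gapCond_map_add]
  · intro q q' h
    have hparts := congrArg (fun p => p.1.parts) h
    exact Subtype.ext (Nat.Partition.ext
      (Multiset.map_injective (add_left_injective (2 * k)) hparts))
  · rintro ⟨p, hcard, hmin, hone, heven, hgap⟩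
    obtain ⟨q, hq⟩ := p.exists_map_add_eq (n := n - 2 * m * k) (2 * k) hmin
      (by rw [hcard, hmul]; omega)
    have hqcard : Multiset.card q.parts = m := by
      simpa [hcard] using congrArg Multiset.card hq
    obtain rfl : q.shiftParts (2 * k) (hshift hqcard) = p := Nat.Partition.ext hq
    refine ⟨⟨q, hqcard, by simpa [hcount] using hone, ?_, ?_⟩, rfl⟩
    · intro x hx hxe
      have := heven (x + 2 * k) (Multiset.mem_map_of_mem _ hx) (by simpa [Nat.even_add] using hxe)
      omega
    · rwa [Nat.Partition.oddParts_shiftParts _ (even_two_mul k), gapCond_map_add] at hgap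
end

section
/- For all integers n ≥ 0, k ≥ 1, and for i = 1 or i = 2, the number P^{2k}_{2,i}(n) of partitions of n all of whose parts are at least 2k, with at most i-1 parts equal to 2k, in which every odd part plus 1 is at least 2(m+k) (where m is the total number of parts), and in which the even parts listed in decreasing order satisfy λ_{i_ℓ} - λ_{i_{ℓ+2}} ≥ 4 for every valid ℓ, equals the number B^{2k}_{2,i}(n) of partitions of n all of whose parts are at least 2k, with at most i-1 parts equal to 2k, and in which any two parts differ by at least 2. -/
/-- `Pbig2k k i n` = number of partitions of `n` (of any length `m`) with all
parts at least `2k`, at most `i - 1` parts equal to `2k`, every odd part plus `1`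
at least `2(m+k)` where `m` is the number of parts, and even parts (in decreasing
order) satisfying `λ_{i_ℓ} - λ_{i_{ℓ+2}} ≥ 4`. -/
noncomputable def Pbig2k (k i n : ℕ) : ℕ :=
  Nat.card {p : n.Partition //
    (∀ x ∈ p.parts, 2 * k ≤ x) ∧
    Multiset.count (2 * k) p.parts ≤ i - 1 ∧
    (∀ x ∈ p.parts, ¬ Even x → 2 * (Multiset.card p.parts + k) ≤ x + 1) ∧
    GapCond p.evenParts 2 4}

/-- `Bbig2k k i n` = number of partitions of `n` with all parts at least `2k`,
at most `i - 1` parts equal to `2k`, and any two parts differing by at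
least `2`. -/
noncomputable def Bbig2k (k i n : ℕ) : ℕ :=
  Nat.card {p : n.Partition //
    (∀ x ∈ p.parts, 2 * k ≤ x) ∧
    Multiset.count (2 * k) p.parts ≤ i - 1 ∧
    GapCond p.sortedParts 1 2}

namespace EvenOdd
open PowerSeries

theorem eq_of_rescale_eq_mul {K : Type*} [Field K] {p : K} (hp : ∀ n : ℕ, 0 < n → p ^ n ≠ 1)
    {F G Q : K⟦X⟧} (hQ : coeff 0 Q = 1) (h0 : coeff 0 F = coeff 0 G)
    (hF : rescale p F = F * Q) (hG : rescale p G = G * Q) : F = G := by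
  ext n
  induction n using Nat.strong_induction_on with
  | _ n ih =>
    rcases Nat.eq_zero_or_pos n with rfl | hn
    · exact h0
    have hF' := congrArg (coeff n) hF
    have hG' := congrArg (coeff n) hG
    rw [coeff_rescale, coeff_mul] at hF' hG'
    have hmem : (n, 0) ∈ Finset.HasAntidiagonal.antidiagonal n := by simp
    rw [← Finset.add_sum_erase _ _ hmem] at hF' hG'
    have hrest : ∑ x ∈ (Finset.HasAntidiagonal.antidiagonal n).erase (n, 0),
          coeff x.1 F * coeff x.2 Q =
        ∑ x ∈ (Finset.HasAntidiagonal.antidiagonal n).erase (n, 0),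
          coeff x.1 G * coeff x.2 Q := by
      refine Finset.sum_congr rfl fun x hx => ?_
      rw [Finset.mem_erase, Finset.HasAntidiagonal.mem_antidiagonal, ne_eq, Prod.ext_iff] at hx
      rw [ih x.1 (by grind)]
    simp only [hQ, mul_one] at hF' hG'
    have : (p ^ n - 1) * (coeff n F - coeff n G) = 0 := by
      linear_combination hF' - hG' + hrest
    rcases mul_eq_zero.1 this with h | h
    · exact absurd (sub_eq_zero.1 h) (hp n hn)
    · exact sub_eq_zero.1 h

theorem rescale_C_apply {R : Type*} [CommSemiring R] (a b : R) : rescale a (C b) = C b := by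
  ext n
  rw [coeff_rescale, coeff_C]
  split_ifs with h <;> simp [h]

/-- A first order recurrence on coefficients, as a functional equation. -/
theorem rescale_eq_of_recurrence {K : Type*} [Field K] {p a : K} {f : ℕ → K}
    (h : ∀ n, f (n + 1) = p ^ (n + 1) * f (n + 1) + a * f n) :
    rescale p (mk f) = mk f * (1 - C a * X) := by
  ext n
  cases n with
  | zero => simp
  | succ n =>
    rw [mul_sub, mul_one, ← mul_assoc, map_sub, coeff_succ_mul_X, coeff_rescale, coeff_mul_C]
    simp only [coeff_mk]
    linear_combination -h n

/-- The convolution of `W₀` and `W₁`, defined by recurrences, with the scaled sequence `u` agrees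
with the doubly indexed sequence `D`. -/
theorem convolution_eq {K : Type*} [Field K] {q : K} (hq0 : q ≠ 0)
    (hq : ∀ n : ℕ, 0 < n → q ^ n ≠ 1) (k : ℕ)
    {W₀ W₁ W₂ u : ℕ → K} {D : ℕ → ℕ → K}
    (hW₂0 : W₂ 0 = 1) (hW₀ : ∀ r, W₀ r = q ^ (2 * r) * W₂ r)
    (hW₁0 : W₁ 0 = W₀ 0)
    (hW₁ : ∀ r, W₁ (r + 1) = W₀ (r + 1) + q ^ (2 * (k + 1)) * (q ^ (2 * r) * W₁ r))
    (hW₂1 : W₂ 1 = W₁ 1)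
    (hW₂ : ∀ r, W₂ (r + 2) = W₁ (r + 2) + q ^ (4 * (k + 1)) * (q ^ (2 * r) * W₀ r))
    (hu0 : u 0 = 1) (hu : ∀ s, u (s + 1) = q ^ (2 * (s + 1)) * u (s + 1) + u s)
    (hD0 : ∀ j, D j 0 = 1)
    (hD : ∀ j m, D j (m + 1) = D (j + 1) (m + 1) + q ^ j * D (j + 2) m)
    (hDs : ∀ j m, D (j + 1) m = q ^ m * D j m) (m : ℕ) :
    ∑ x ∈ Finset.HasAntidiagonal.antidiagonal m,
          W₀ x.1 * (q ^ x.2 * (q ^ (2 * (m + k) * x.2) * u x.2))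
        = D (2 * k + 3) m ∧
      ∑ x ∈ Finset.HasAntidiagonal.antidiagonal m,
          W₁ x.1 * (q ^ x.2 * (q ^ (2 * (m + k) * x.2) * u x.2))
        = D (2 * k + 2) m := by
  have hqp : ∀ n : ℕ, q ^ n ≠ 0 := fun n => pow_ne_zero n hq0
  set c : K := q ^ (2 * k) with hc
  set w : (ℕ → K) → K⟦X⟧ := fun W => mk fun r => (q ^ (r ^ 2))⁻¹ * W r with hw
  set o : K⟦X⟧ := mk fun s => q ^ (s ^ 2 + s + 2 * k * s) * u s with ho
  have e₀ : w W₀ = rescale (q ^ 2) (w W₂) := by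
    ext n
    simp only [hw, coeff_rescale, coeff_mk, hW₀, pow_mul]
    ring
  have e₁ : w W₁ * (1 - C (c * q) * X) = w W₀ := by
    ext n
    rw [mul_sub, mul_one, ← mul_assoc, map_sub]
    cases n with
    | zero => simp [hw, hW₁0]
    | succ n =>
      rw [coeff_succ_mul_X, coeff_mul_C]
      simp only [hw, coeff_mk, hW₁]
      have h1 := hqp ((n + 1) ^ 2)
      have h2 := hqp (n ^ 2)
      field_simp
      rw [hc]
      ring
  have e₂ : w W₂ * (1 - C (c ^ 2) * X ^ 2) = w W₁ := by
    ext n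
    rw [mul_sub, mul_one, ← mul_assoc, map_sub]
    match n with
    | 0 => simp [hw, hW₁0, hW₀]
    | 1 => rw [coeff_mul_X_pow']; simp [hw, hW₂1]
    | n + 2 =>
      rw [coeff_mul_X_pow, coeff_mul_C]
      simp only [hw, coeff_mk, hW₂, hW₀]
      have h1 := hqp ((n + 2) ^ 2)
      have h2 := hqp (n ^ 2)
      field_simp
      rw [hc]
      ring
  have eo : o = rescale (q ^ 2) o * (1 + C (c * q ^ 2) * X) := by
    ext n
    rw [mul_add, mul_one, ← mul_assoc, map_add]
    cases n with
    | zero => simp [ho]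
    | succ n =>
      rw [coeff_succ_mul_X, coeff_mul_C]
      simp only [ho, coeff_rescale, coeff_mk]
      have := hu n
      rw [hc]
      linear_combination q ^ ((n + 1) ^ 2 + (n + 1) + 2 * k * (n + 1)) * this
  have ed : ∀ j, rescale q (w (D (j + 1))) = w (D (j + 1)) * (1 - C (q ^ j) * X) := by
    intro j
    refine rescale_eq_of_recurrence fun m => ?_
    have h1 := hqp ((m + 1) ^ 2)
    have h2 := hqp (m ^ 2)
    have h3 := hD (j + 1) m
    rw [hDs (j + 2) m, hDs (j + 1) m, hDs (j + 1) (m + 1)] at h3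
    field_simp
    linear_combination q ^ (m ^ 2) * h3
  have ed' : rescale q (w (D (2 * k + 2))) = w (D (2 * k + 3)) := by
    ext n
    simp only [hw, coeff_rescale, coeff_mk, hDs (2 * k + 2)]
    ring
  have one_ne : ∀ a : K, (1 + C a * X : K⟦X⟧) ≠ 0 := fun a h => by
    simpa using congrArg (coeff 0) h
  have one_ne' : ∀ a : K, (1 - C a * X : K⟦X⟧) ≠ 0 := fun a h => by
    simpa using congrArg (coeff 0) h
  have key₀ : w W₀ * o = w (D (2 * k + 3)) := by
    refine eq_of_rescale_eq_mul (p := q ^ 2)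
      (Q := (1 - C (c * q ^ 2) * X) * (1 - C (c * q ^ 3) * X)) ?_ ?_ ?_ ?_ ?_
    · intro n hn
      rw [← pow_mul]
      exact hq _ (by omega)
    · simp
    · simp [hw, ho, hW₀, hW₂0, hu0, hD0]
    · apply mul_right_cancel₀ (one_ne (c * q ^ 2))
      have h₁ := congrArg (rescale (q ^ 2)) e₁
      have h₂ := congrArg (rescale (q ^ 2)) e₂
      simp only [map_mul, map_sub, map_one, map_pow, rescale_X, rescale_C_apply, ← e₀]
        at h₁ h₂
      simp only [map_mul, map_pow] at eo ⊢
      linear_combination -rescale (q ^ 2) (w W₀) * eo - o * h₁ -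
        o * (1 - C c * C q * (C q ^ 2 * X)) * h₂
    · have h := ed (2 * k + 2)
      have h₂ := congrArg (rescale q) h
      rw [rescale_rescale, map_mul, h] at h₂
      rw [sq, h₂, hc]
      simp only [map_mul, map_sub, map_one, map_pow, rescale_X, rescale_C_apply]
      ring
  have key₁ : w W₁ * o = w (D (2 * k + 2)) := by
    apply mul_right_cancel₀ (one_ne' (c * q))
    have h := ed (2 * k + 1)
    rw [ed', ← key₀, ← e₁, pow_succ, ← hc] at h
    linear_combination h
  have conv : ∀ W : ℕ → K,
      ∑ x ∈ Finset.HasAntidiagonal.antidiagonal m,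
          W x.1 * (q ^ x.2 * (q ^ (2 * (m + k) * x.2) * u x.2))
        = q ^ (m ^ 2) * coeff m (w W * o) := by
    intro W
    rw [coeff_mul, Finset.mul_sum]
    refine Finset.sum_congr rfl fun x hx => ?_
    rw [← Finset.HasAntidiagonal.mem_antidiagonal.1 hx]
    simp only [hw, ho, coeff_mk]
    have h2 := hqp (x.1 ^ 2)
    field_simp
    ring
  constructor
  · rw [conv, key₀]
    simp [hw, hqp]
  · rw [conv, key₁]
    simp [hw, hqp]

/-- The generating function of a set `S` with respect to the weight `w`. -/
noncomputable def gf {α : Type*} (w : α → ℕ) (S : Set α) : ℤ⟦X⟧ :=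
  mk fun n => ((S ∩ w ⁻¹' {n}).ncard : ℤ)

section Gf
variable {α β : Type*} {w : α → ℕ} {S : Set α}

theorem coeff_gf (w : α → ℕ) (S : Set α) (n : ℕ) :
    coeff n (gf w S) = ((S ∩ w ⁻¹' {n}).ncard : ℤ) := coeff_mk ..

theorem ncard_eq_sum_fiber {ι : Type*} (hS : S.Finite) (f : α → ι) (I : Finset ι)
    (hf : ∀ x ∈ S, f x ∈ I) : S.ncard = ∑ i ∈ I, (S ∩ f ⁻¹' {i}).ncard := by
  classical
  lift S to Finset α using hS
  rw [Set.ncard_coe_finset, Finset.card_eq_sum_card_fiberwise hf]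
  refine Finset.sum_congr rfl fun i _ => ?_
  rw [← Set.ncard_coe_finset]
  congr 1
  ext
  simp

theorem gf_eq_sum_fiber {ι : Type*} (hS : ∀ n, (S ∩ w ⁻¹' {n}).Finite) (f : α → ι) (I : Finset ι)
    (hf : ∀ x ∈ S, f x ∈ I) : gf w S = ∑ i ∈ I, gf w (S ∩ f ⁻¹' {i}) := by
  ext n
  rw [map_sum, coeff_gf, ncard_eq_sum_fiber (hS n) f I fun x hx => hf x hx.1, Nat.cast_sum]
  simp_rw [coeff_gf, Set.inter_right_comm]

theorem gf_eq_add (hS : ∀ n, (S ∩ w ⁻¹' {n}).Finite) {A B : Set α} (hAB : Disjoint A B)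
    (h : S = A ∪ B) : gf w S = gf w A + gf w B := by
  subst h
  ext n
  have hn := hS n
  rw [Set.union_inter_distrib_right] at hn
  rw [map_add, coeff_gf, coeff_gf, coeff_gf, Set.union_inter_distrib_right,
    Set.ncard_union_eq (hAB.mono Set.inter_subset_left Set.inter_subset_left)
      (hn.subset Set.subset_union_left) (hn.subset Set.subset_union_right), Nat.cast_add]

theorem gf_eq_X_pow_mul {v : β → ℕ} {T : Set β} {f : α → β} (hf : Set.BijOn f S T) {c : ℕ}
    (hw : ∀ x ∈ S, v (f x) = w x + c) : gf v T = X ^ c * gf w S := by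
  ext n
  rw [coeff_X_pow_mul', coeff_gf]
  split_ifs with h
  · rw [coeff_gf]
    congr 1
    symm
    refine Set.BijOn.ncard_eq (f := f) ⟨?_, hf.injOn.mono Set.inter_subset_left, ?_⟩
    · rintro x ⟨hx, hn⟩
      refine ⟨hf.mapsTo hx, ?_⟩
      simp only [Set.mem_preimage, Set.mem_singleton_iff] at hn ⊢
      rw [hw x hx]
      omega
    · rintro y ⟨hy, hn⟩
      obtain ⟨x, hx, rfl⟩ := hf.surjOn hy
      refine ⟨x, ⟨hx, ?_⟩, rfl⟩
      simp only [Set.mem_preimage, Set.mem_singleton_iff] at hn ⊢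
      rw [hw x hx] at hn
      omega
  · rw [Nat.cast_eq_zero]
    convert Set.ncard_empty β
    rw [Set.eq_empty_iff_forall_notMem]
    rintro y ⟨hy, hn⟩
    obtain ⟨x, hx, rfl⟩ := hf.surjOn hy
    simp only [Set.mem_preimage, Set.mem_singleton_iff] at hn
    rw [hw x hx] at hn
    omega

theorem gf_prod {v : β → ℕ} {T : Set β} (hS : ∀ n, (S ∩ w ⁻¹' {n}).Finite)
    (hT : ∀ n, (T ∩ v ⁻¹' {n}).Finite) :
    gf (fun x : α × β => w x.1 + v x.2) (S ×ˢ T) = gf w S * gf v T := by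
  ext n
  have key : ∀ i ∈ Finset.HasAntidiagonal.antidiagonal n,
      (((S ×ˢ T) ∩ (fun x : α × β => w x.1 + v x.2) ⁻¹' {n}) ∩
        (fun x : α × β => (w x.1, v x.2)) ⁻¹' {i}) =
      (S ∩ w ⁻¹' {i.1}) ×ˢ (T ∩ v ⁻¹' {i.2}) := by
    intro i hi
    rw [Finset.HasAntidiagonal.mem_antidiagonal] at hi
    ext x
    simp only [Set.mem_inter_iff, Set.mem_prod, Set.mem_preimage, Set.mem_singleton_iff,
      Prod.ext_iff]
    grind
  rw [coeff_mul, coeff_gf, ncard_eq_sum_fiber (f := fun x : α × β => (w x.1, v x.2))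
    (I := Finset.HasAntidiagonal.antidiagonal n), Nat.cast_sum]
  · refine Finset.sum_congr rfl fun i hi => ?_
    rw [key i hi, Set.ncard_prod, coeff_gf, coeff_gf, Nat.cast_mul]
  · refine (Set.Finite.biUnion (Finset.finite_toSet (Finset.HasAntidiagonal.antidiagonal n))
      fun i _ => (hS i.1).prod (hT i.2)).subset ?_
    rintro x ⟨hx, hn⟩
    simp only [Set.mem_preimage, Set.mem_singleton_iff] at hn
    simp only [Set.mem_iUnion]
    exact ⟨(w x.1, v x.2), by simpa using hn, ⟨hx.1, rfl⟩, hx.2, rfl⟩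
  · rintro x ⟨-, hn⟩
    simpa using hn

end Gf

/-- Multisets of `r` integers `≥ j`, with at most `a` entries equal to `j` and at most `b` entries
in any pair of consecutive values. -/
def gapSet (b j a r : ℕ) : Set (Multiset ℕ) :=
  {μ | (∀ x ∈ μ, j ≤ x) ∧ μ.count j ≤ a ∧ (∀ x, μ.count x + μ.count (x + 1) ≤ b) ∧ μ.card = r}

/-- Multisets of `s` integers `≥ t`. -/
def lowerSet (t s : ℕ) : Set (Multiset ℕ) :=
  {μ | (∀ x ∈ μ, t ≤ x) ∧ μ.card = s}

/-- The weight `μ ↦ c * ∑ μ`. -/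
def wt (c : ℕ) (μ : Multiset ℕ) : ℕ := c * μ.sum

theorem finite_card_wt {c r n : ℕ} (hc : 0 < c) :
    {μ : Multiset ℕ | μ.card = r ∧ wt c μ = n}.Finite := by
  refine (Set.finite_Iic (r • (Multiset.range (n + 1)))).subset ?_
  rintro μ ⟨hr, hn⟩
  rw [Set.mem_Iic, Multiset.le_iff_count]
  intro x
  by_cases hx : x ∈ μ
  · have h₁ : x ≤ μ.sum := Multiset.le_sum_of_mem hx
    have h₂ : μ.sum ≤ n := hn ▸ Nat.le_mul_of_pos_left _ hc
    rw [Multiset.count_nsmul, Multiset.count_eq_one_of_mem (Multiset.nodup_range _)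
      (Multiset.mem_range.2 (by omega)), mul_one, ← hr]
    exact Multiset.count_le_card _ _
  · simp [Multiset.count_eq_zero_of_notMem hx]

theorem finite_gapSet {c : ℕ} (hc : 0 < c) (b j a r n : ℕ) :
    (gapSet b j a r ∩ wt c ⁻¹' {n}).Finite :=
  (finite_card_wt (r := r) (n := n) hc).subset fun _ h => ⟨h.1.2.2.2, h.2⟩

theorem finite_lowerSet {c : ℕ} (hc : 0 < c) (t s n : ℕ) :
    (lowerSet t s ∩ wt c ⁻¹' {n}).Finite :=
  (finite_card_wt (r := s) (n := n) hc).subset fun _ h => ⟨h.1.2, h.2⟩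

theorem gf_singleton_zero (c : ℕ) : gf (wt c) {0} = 1 := by
  ext n
  rw [coeff_gf, coeff_one]
  split_ifs with h
  · subst h
    rw [Set.inter_eq_left.2 (by simp [wt])]
    simp
  · rw [Set.singleton_inter_eq_empty.2 (by simpa [wt] using Ne.symm h)]
    simp

theorem gf_gapSet_zero_right (c b j a : ℕ) : gf (wt c) (gapSet b j a 0) = 1 := by
  rw [← gf_singleton_zero c]
  congr 1
  ext μ
  simp only [gapSet, Set.mem_ofPred_eq, Set.mem_singleton_iff, Multiset.card_eq_zero]
  exact ⟨fun h => h.2.2.2, by rintro rfl; simp⟩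

theorem gf_lowerSet_zero_right (c t : ℕ) : gf (wt c) (lowerSet t 0) = 1 := by
  rw [← gf_singleton_zero c]
  congr 1
  ext μ
  simp +contextual [lowerSet]

theorem wt_map_succ (c : ℕ) (μ : Multiset ℕ) :
    wt c (μ.map (· + 1)) = wt c μ + c * μ.card := by
  simp [wt, Multiset.sum_map_add, mul_add]

theorem map_succ_map_pred {μ : Multiset ℕ} {j : ℕ} (h : ∀ x ∈ μ, j + 1 ≤ x) :
    (μ.map (· - 1)).map (· + 1) = μ := by
  rw [Multiset.map_map]
  conv_rhs => rw [← Multiset.map_id μ]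
  refine Multiset.map_congr rfl fun x hx => ?_
  have := h x hx
  simp only [Function.comp, id]
  omega

theorem count_map_succ (μ : Multiset ℕ) (x : ℕ) : (μ.map (· + 1)).count (x + 1) = μ.count x :=
  Multiset.count_map_eq_count' _ _ (add_left_injective 1) x

theorem count_zero_map_succ (μ : Multiset ℕ) : (μ.map (· + 1)).count 0 = 0 := by
  simp

theorem map_succ_mem_gapSet {b j a r : ℕ} {μ : Multiset ℕ} :
    μ.map (· + 1) ∈ gapSet b (j + 1) a r ↔ μ ∈ gapSet b j a r := by
  simp only [gapSet, Set.mem_ofPred_eq, count_map_succ, Multiset.card_map, Multiset.mem_map,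
    forall_exists_index, and_imp, forall_apply_eq_imp_iff₂, add_le_add_iff_right]
  refine and_congr_right fun hj => and_congr_right fun ha => and_congr_left fun _ => ?_
  constructor
  · intro h x
    simpa only [count_map_succ] using h (x + 1)
  · rintro h (_ | x)
    · have := h 0
      rw [count_zero_map_succ]
      omega
    · simpa only [count_map_succ] using h x

theorem gf_gapSet_succ (c b j a r : ℕ) :
    gf (wt c) (gapSet b (j + 1) a r) = X ^ (c * r) * gf (wt c) (gapSet b j a r) := by
  refine gf_eq_X_pow_mul (f := Multiset.map (· + 1)) ⟨fun μ h => map_succ_mem_gapSet.2 h,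
    (Multiset.map_injective (add_left_injective 1)).injOn, fun μ h => ?_⟩ fun μ h => ?_
  · have e := map_succ_map_pred h.1
    exact ⟨_, map_succ_mem_gapSet.1 (by rwa [e]), e⟩
  · rw [wt_map_succ, h.2.2.2]

theorem gf_lowerSet_succ (c t s : ℕ) :
    gf (wt c) (lowerSet (t + 1) s) = X ^ (c * s) * gf (wt c) (lowerSet t s) := by
  have key : ∀ μ : Multiset ℕ, μ.map (· + 1) ∈ lowerSet (t + 1) s ↔ μ ∈ lowerSet t s := by
    simp [lowerSet]
  refine gf_eq_X_pow_mul (f := Multiset.map (· + 1)) ⟨fun μ h => (key _).2 h,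
    (Multiset.map_injective (add_left_injective 1)).injOn, fun μ h => ?_⟩ fun μ h => ?_
  · have e := map_succ_map_pred h.1
    exact ⟨_, (key _).1 (by rwa [e]), e⟩
  · rw [wt_map_succ, h.2]

theorem gf_lowerSet_add_one {c : ℕ} (hc : 0 < c) (t s : ℕ) :
    gf (wt c) (lowerSet t (s + 1)) =
      gf (wt c) (lowerSet (t + 1) (s + 1)) + X ^ (c * t) * gf (wt c) (lowerSet t s) := by
  have hb : Set.BijOn (Multiset.cons t) (lowerSet t s) (lowerSet t (s + 1) ∩ {μ | t ∈ μ}) := by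
    refine ⟨?_, fun _ _ _ _ h => by simpa using h, ?_⟩
    · rintro μ ⟨h₁, h₂⟩
      simpa [lowerSet, h₂] using h₁
    · rintro μ ⟨⟨h₁, h₂⟩, h₃⟩
      obtain ⟨ν, rfl⟩ := Multiset.exists_cons_of_mem h₃
      refine ⟨ν, ⟨fun x hx => h₁ x (Multiset.mem_cons_of_mem hx), by simpa using h₂⟩, rfl⟩
  rw [← gf_eq_X_pow_mul hb (v := wt c) fun μ _ => by simp [wt]; ring]
  refine gf_eq_add (finite_lowerSet hc _ _) ?_ ?_
  · rw [Set.disjoint_left]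
    rintro μ h ⟨-, h'⟩
    have := h.1 t h'
    omega
  · ext μ
    simp only [lowerSet, Set.mem_union, Set.mem_inter_iff, Set.mem_ofPred_eq]
    constructor
    · rintro ⟨h₁, h₂⟩
      by_cases ht : t ∈ μ
      · exact Or.inr ⟨⟨h₁, h₂⟩, ht⟩
      · refine Or.inl ⟨fun x hx => ?_, h₂⟩
        exact Nat.lt_of_le_of_ne (h₁ x hx) fun e => ht (e ▸ hx)
    · rintro (⟨h₁, h₂⟩ | h)
      · exact ⟨fun x hx => (Nat.le_succ t).trans (h₁ x hx), h₂⟩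
      · exact h.1

theorem gapSet_zero_count (b j r : ℕ) : gapSet b j 0 r = gapSet b (j + 1) b r := by
  ext μ
  simp only [gapSet, Set.mem_ofPred_eq, Nat.le_zero, Multiset.count_eq_zero]
  constructor
  · rintro ⟨h₁, h₂, h₃, h₄⟩
    refine ⟨fun x hx => Nat.lt_of_le_of_ne (h₁ x hx) fun e => h₂ (e ▸ hx), ?_, h₃, h₄⟩
    have := h₃ (j + 1)
    omega
  · rintro ⟨h₁, h₂, h₃, h₄⟩
    refine ⟨fun x hx => (Nat.le_succ j).trans (h₁ x hx), fun h => ?_, h₃, h₄⟩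
    have := h₁ j h
    omega

theorem gapSet_succ_count_of_lt {b j a r : ℕ} (h : r ≤ a) :
    gapSet b j (a + 1) r = gapSet b j a r := by
  ext μ
  simp only [gapSet, Set.mem_ofPred_eq]
  refine and_congr_right fun _ => and_congr_left fun h' => ?_
  have := Multiset.count_le_card j μ
  omega

theorem gf_gapSet_succ_count {c : ℕ} (hc : 0 < c) {b a : ℕ} (j r : ℕ) (hab : a + 1 ≤ b) :
    gf (wt c) (gapSet b j (a + 1) (r + (a + 1))) =
      gf (wt c) (gapSet b j a (r + (a + 1))) +
        X ^ (c * (a + 1) * j) * gf (wt c) (gapSet b (j + 1) (b - (a + 1)) r) := by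
  have hb : Set.BijOn (· + Multiset.replicate (a + 1) j) (gapSet b (j + 1) (b - (a + 1)) r)
      (gapSet b j (a + 1) (r + (a + 1)) ∩ {μ | μ.count j = a + 1}) := by
    have hlt : ∀ {ν : Multiset ℕ} {x}, x < j + 1 → (∀ x ∈ ν, j + 1 ≤ x) → ν.count x = 0 := by
      intro ν x hx h
      rw [Multiset.count_eq_zero]
      intro h'
      have := h x h'
      omega
    have hj : ∀ {ν : Multiset ℕ}, (∀ x ∈ ν, j + 1 ≤ x) → ν.count j = 0 := hlt (Nat.lt_succ_self j)
    refine ⟨?_, fun _ _ _ _ h => by simpa using h, ?_⟩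
    · rintro μ ⟨h₁, h₂, h₃, h₄⟩
      refine ⟨⟨?_, ?_, ?_, ?_⟩, ?_⟩
      · intro x hx
        rcases Multiset.mem_add.1 hx with hx | hx
        · exact (Nat.le_succ j).trans (h₁ x hx)
        · exact (Multiset.eq_of_mem_replicate hx).ge
      · simp [hj h₁]
      · intro x
        have := h₃ x
        simp only [Multiset.count_add, Multiset.count_replicate]
        split_ifs with e₁ e₂ e₂
        · omega
        · subst e₁
          rw [hj h₁]
          omega
        · subst e₂
          rw [hj h₁, hlt (by omega) h₁]
          omega
        · omega
      · simp [h₄, add_assoc]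
      · simp [hj h₁]
    · rintro μ ⟨⟨h₁, h₂, h₃, h₄⟩, h₅⟩
      have hle : Multiset.replicate (a + 1) j ≤ μ := Multiset.le_count_iff_replicate_le.1 h₅.ge
      obtain ⟨ν, rfl⟩ := Multiset.le_iff_exists_add.1 hle
      simp only [Set.mem_ofPred_eq, Multiset.count_add, Multiset.count_replicate_self] at h₅
      have hν : ∀ x ∈ ν, j + 1 ≤ x := by
        intro x hx
        refine Nat.lt_of_le_of_ne (h₁ x (Multiset.mem_add.2 (Or.inr hx))) ?_
        rintro rfl
        have := Multiset.count_pos.2 hx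
        omega
      refine ⟨ν, ⟨hν, ?_, fun x => ?_, ?_⟩, add_comm _ _⟩
      · have := h₃ j
        simp only [Multiset.count_add, Multiset.count_replicate_self] at this
        omega
      · have := h₃ x
        simp only [Multiset.count_add] at this
        omega
      · simp at h₄
        omega
  rw [← gf_eq_X_pow_mul hb (v := wt c) fun μ _ => by simp [wt]; ring]
  refine gf_eq_add (finite_gapSet hc _ _ _ _) ?_ ?_
  · rw [Set.disjoint_left]
    rintro μ h ⟨-, h'⟩
    have := h.2.1
    simp only [Set.mem_ofPred_eq] at h'
    omega
  · ext μ
    simp only [gapSet, Set.mem_union, Set.mem_inter_iff, Set.mem_ofPred_eq]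
    grind

/-- Multisets of `m` integers obeying the parity dependent conditions, the gap condition on even
entries being expressed through multiplicities. -/
def evenOddSet (k a m : ℕ) : Set (Multiset ℕ) :=
  {μ | (∀ x ∈ μ, 2 * k ≤ x) ∧ μ.count (2 * k) ≤ a ∧
    (∀ x ∈ μ, ¬ Even x → 2 * (m + k) ≤ x + 1) ∧
    (∀ x, μ.count (2 * x) + μ.count (2 * (x + 1)) ≤ 2) ∧ μ.card = m}

theorem finite_evenOddSet (k a m n : ℕ) : (evenOddSet k a m ∩ wt 1 ⁻¹' {n}).Finite :=
  (finite_card_wt (r := m) (n := n) one_pos).subset fun _ h => ⟨h.1.2.2.2.2, h.2⟩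

/-- The multiset whose even entries are the doubles of the entries of the first component, and
whose odd entries are `2 * y + 1`, for `y` in the second component. -/
def merge (x : Multiset ℕ × Multiset ℕ) : Multiset ℕ :=
  x.1.map (2 * ·) + x.2.map (2 * · + 1)

theorem filter_even_merge (x : Multiset ℕ × Multiset ℕ) :
    (merge x).filter (fun y => Even y) = x.1.map (2 * ·) := by
  rw [merge, Multiset.filter_add, Multiset.filter_eq_self.2, Multiset.filter_eq_nil.2, add_zero]
  · simp
  · simp

theorem filter_not_even_merge (x : Multiset ℕ × Multiset ℕ) :
    (merge x).filter (fun y => ¬ Even y) = x.2.map (2 * · + 1) := by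
  rw [merge, Multiset.filter_add, Multiset.filter_eq_nil.2, Multiset.filter_eq_self.2, zero_add]
  · simp
  · simp

theorem injective_two_mul : Function.Injective (2 * · : ℕ → ℕ) := fun x y h => by
  simpa using h

theorem injective_two_mul_add_one : Function.Injective (2 * · + 1 : ℕ → ℕ) := fun x y h => by
  simpa using h

theorem merge_injective : Function.Injective merge := by
  intro x y h
  have h₁ := congrArg (Multiset.filter (fun y => Even y)) h
  have h₂ := congrArg (Multiset.filter (fun y => ¬ Even y)) h
  rw [filter_even_merge, filter_even_merge] at h₁
  rw [filter_not_even_merge, filter_not_even_merge] at h₂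
  exact Prod.ext (Multiset.map_injective injective_two_mul h₁)
    (Multiset.map_injective injective_two_mul_add_one h₂)

theorem merge_surjective : Function.Surjective merge := by
  intro μ
  refine ⟨((μ.filter (fun y => Even y)).map (· / 2),
    (μ.filter (fun y => ¬ Even y)).map (· / 2)), ?_⟩
  rw [merge, Multiset.map_map, Multiset.map_map]
  nth_rw 3 [← Multiset.filter_add_not (fun y => Even y) μ]
  congr 1
  · conv_rhs => rw [← Multiset.map_id (μ.filter _)]
    refine Multiset.map_congr rfl fun x hx => ?_
    have := (Multiset.mem_filter.1 hx).2
    simp only [Function.comp, id]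
    grind
  · conv_rhs => rw [← Multiset.map_id (μ.filter _)]
    refine Multiset.map_congr rfl fun x hx => ?_
    have := (Multiset.mem_filter.1 hx).2
    simp only [Function.comp, id]
    grind

theorem count_two_mul_merge (x : Multiset ℕ × Multiset ℕ) (y : ℕ) :
    (merge x).count (2 * y) = x.1.count y := by
  rw [merge, Multiset.count_add, Multiset.count_map_eq_count' _ _ injective_two_mul,
    Multiset.count_eq_zero (s := x.2.map _) |>.2, add_zero]
  simp only [Multiset.mem_map, not_exists, not_and]
  omega

theorem card_merge (x : Multiset ℕ × Multiset ℕ) : (merge x).card = x.1.card + x.2.card := by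
  simp [merge]

theorem wt_merge (x : Multiset ℕ × Multiset ℕ) :
    wt 1 (merge x) = wt 2 x.1 + wt 2 x.2 + x.2.card := by
  have h : ∀ μ : Multiset ℕ, (μ.map (2 * ·)).sum = 2 * μ.sum := fun μ => by
    simpa using Multiset.sum_map_mul_left (s := μ) (a := 2) (f := id)
  simp only [wt, merge, Multiset.sum_map_add, Multiset.sum_add, h, Multiset.map_const',
    Multiset.sum_replicate, smul_eq_mul]
  ring

theorem merge_mem_evenOddSet {k a m : ℕ} (x : Multiset ℕ × Multiset ℕ) :
    merge x ∈ evenOddSet (k + 1) a m ↔ x.1.card + x.2.card = m ∧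
      x.1 ∈ gapSet 2 (k + 1) a x.1.card ∧ x.2 ∈ lowerSet (m + k) x.2.card := by
  simp only [evenOddSet, gapSet, lowerSet, Set.mem_ofPred_eq, count_two_mul_merge, card_merge]
  have h₁ : (∀ y ∈ merge x, 2 * (k + 1) ≤ y) ↔
      (∀ y ∈ x.1, k + 1 ≤ y) ∧ ∀ y ∈ x.2, k + 1 ≤ y := by
    simp only [merge, Multiset.mem_add, Multiset.mem_map, or_imp, forall_and,
      forall_exists_index, and_imp, forall_apply_eq_imp_iff₂]
    exact and_congr (forall₂_congr fun y _ => by omega) (forall₂_congr fun y _ => by omega)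
  have h₂ : (∀ y ∈ merge x, ¬ Even y → 2 * (m + (k + 1)) ≤ y + 1) ↔ ∀ y ∈ x.2, m + k ≤ y := by
    simp only [merge, Multiset.mem_add, Multiset.mem_map, or_imp, forall_and,
      forall_exists_index, and_imp, forall_apply_eq_imp_iff₂]
    rw [and_iff_right fun y _ h => absurd (even_two_mul y) h]
    refine forall₂_congr fun y _ => ?_
    rw [imp_iff_right (by simp)]
    omega
  have h₃ : x.1.card + x.2.card = m → (∀ y ∈ x.2, m + k ≤ y) → ∀ y ∈ x.2, k + 1 ≤ y := by
    intro hm h y hy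
    have := h y hy
    have := Multiset.card_pos_iff_exists_mem.2 ⟨y, hy⟩
    omega
  rw [h₁, h₂]
  tauto

theorem gf_evenOddSet (k a m : ℕ) :
    gf (wt 1) (evenOddSet (k + 1) a m) = ∑ x ∈ Finset.HasAntidiagonal.antidiagonal m,
      gf (wt 2) (gapSet 2 (k + 1) a x.1) *
        (X ^ x.2 * gf (wt 2) (lowerSet (m + k) x.2)) := by
  have hbij : Function.Bijective merge := ⟨merge_injective, merge_surjective⟩
  set e := Equiv.ofBijective merge hbij with he
  have hes : ∀ x, e.symm (merge x) = x := fun x => e.symm_apply_apply x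
  rw [gf_eq_sum_fiber (finite_evenOddSet _ _ _)
    (fun μ => ((e.symm μ).1.card, (e.symm μ).2.card)) (Finset.HasAntidiagonal.antidiagonal m)]
  · refine Finset.sum_congr rfl fun i hi => ?_
    rw [Finset.HasAntidiagonal.mem_antidiagonal] at hi
    rw [mul_left_comm, ← gf_prod (finite_gapSet two_pos _ _ _ _) (finite_lowerSet two_pos _ _)]
    refine gf_eq_X_pow_mul (f := merge) ⟨?_, merge_injective.injOn, ?_⟩ ?_
    · rintro x ⟨h₁, h₂⟩
      have c₁ := h₁.2.2.2
      have c₂ := h₂.2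
      refine ⟨(merge_mem_evenOddSet x).2 ⟨by rw [c₁, c₂, hi], c₁ ▸ h₁, c₂ ▸ h₂⟩, ?_⟩
      simp [hes, c₁, c₂]
    · rintro μ ⟨h₁, h₂⟩
      obtain ⟨x, rfl⟩ := merge_surjective μ
      obtain ⟨-, h₃, h₄⟩ := (merge_mem_evenOddSet x).1 h₁
      simp only [Set.mem_preimage, hes, Set.mem_singleton_iff, Prod.ext_iff] at h₂
      rw [h₂.1] at h₃
      rw [h₂.2] at h₄
      exact ⟨x, ⟨h₃, h₄⟩, rfl⟩
    · rintro x ⟨-, h₂⟩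
      rw [wt_merge, h₂.2]
  · intro μ h
    obtain ⟨x, rfl⟩ := merge_surjective μ
    rw [Finset.HasAntidiagonal.mem_antidiagonal, hes]
    exact ((merge_mem_evenOddSet x).1 h).1

theorem gf_evenOddSet_eq (k m : ℕ) :
    gf (wt 1) (evenOddSet (k + 1) 0 m) = gf (wt 1) (gapSet 1 (2 * k + 3) 1 m) ∧
    gf (wt 1) (evenOddSet (k + 1) 1 m) = gf (wt 1) (gapSet 1 (2 * k + 2) 1 m) := by
  set φ := algebraMap ℤ⟦X⟧ (FractionRing ℤ⟦X⟧) with hφ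
  have hinj : Function.Injective φ := IsFractionRing.injective _ _
  have hpow : ∀ n : ℕ, 0 < n → φ X ^ n ≠ 1 := by
    intro n hn h
    rw [← map_pow, ← map_one φ] at h
    have := congrArg (coeff 0) (hinj h)
    rw [coeff_X_pow, if_neg hn.ne, coeff_zero_one] at this
    exact zero_ne_one this
  have hX : φ X ≠ 0 := by
    rw [ne_eq, ← map_zero φ]
    exact fun h => X_ne_zero (hinj h)
  have low : ∀ t s, gf (wt 2) (lowerSet t s) =
      X ^ (2 * t * s) * gf (wt 2) (lowerSet 0 s) := by
    intro t s
    induction t with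
    | zero => simp
    | succ t ih => rw [gf_lowerSet_succ, ih]; ring
  have main := convolution_eq hX hpow k
    (W₀ := fun r => φ (gf (wt 2) (gapSet 2 (k + 1) 0 r)))
    (W₁ := fun r => φ (gf (wt 2) (gapSet 2 (k + 1) 1 r)))
    (W₂ := fun r => φ (gf (wt 2) (gapSet 2 (k + 1) 2 r)))
    (u := fun s => φ (gf (wt 2) (lowerSet 0 s)))
    (D := fun j r => φ (gf (wt 1) (gapSet 1 j 1 r)))
    (by simp [gf_gapSet_zero_right])
    (fun r => by
      simp only [gapSet_zero_count, gf_gapSet_succ 2, map_mul, map_pow])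
    (by simp [gf_gapSet_zero_right])
    (fun r => by
      have := gf_gapSet_succ_count two_pos (a := 0) (b := 2) (k + 1) r (by norm_num)
      rw [gf_gapSet_succ (j := k + 1) 2] at this
      simpa using congrArg φ this)
    (by rw [gapSet_succ_count_of_lt le_rfl])
    (fun r => by
      have := gf_gapSet_succ_count two_pos (a := 1) (b := 2) (k + 1) r (by norm_num)
      rw [gf_gapSet_succ (j := k + 1) 2] at this
      simpa using congrArg φ this)
    (by simp [gf_lowerSet_zero_right])
    (fun s => by
      have := gf_lowerSet_add_one two_pos 0 s
      rw [gf_lowerSet_succ] at this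
      simpa using congrArg φ this)
    (fun j => by simp [gf_gapSet_zero_right])
    (fun j m => by
      have := gf_gapSet_succ_count one_pos (a := 0) (b := 1) j m (by norm_num)
      rw [gapSet_zero_count, zero_add, Nat.sub_self, gapSet_zero_count] at this
      simpa using congrArg φ this)
    (fun j m => by simp [gf_gapSet_succ 1])
    m
  constructor <;> apply hinj
  · rw [← main.1, gf_evenOddSet]
    simp only [map_sum, map_mul, map_pow, low (m + k)]
  · rw [← main.2, gf_evenOddSet]
    simp only [map_sum, map_mul, map_pow, low (m + k)]

theorem gapCond_iff {L : List ℕ} (hL : L.Pairwise (· ≤ ·)) {d g : ℕ} (hg : 0 < g) :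
    GapCond L d g ↔ ∀ x, (L.filter (fun y => x ≤ y ∧ y < x + g)).length ≤ d := by
  constructor
  · intro h x
    by_contra! hd
    set F := L.filter (fun y => x ≤ y ∧ y < x + g) with hF
    obtain ⟨f, hf⟩ : ∃ f : Fin F.length ↪o Fin L.length, ∀ i, F.get i = L.get (f i) :=
      List.sublist_iff_exists_fin_orderEmbedding_get_eq.1 List.filter_sublist
    have hmem : ∀ i : Fin F.length, x ≤ L[f i] ∧ L[f i] < x + g := by
      intro i
      have h₁ : F.get i ∈ F := List.get_mem _ _
      rw [hf] at h₁
      simpa using (List.mem_filter.1 h₁).2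
    have hlt : ∀ e (he : e < F.length), (f ⟨0, by omega⟩ : ℕ) + e ≤ f ⟨e, he⟩ := by
      intro e
      induction e with
      | zero => intro _; exact le_rfl
      | succ e ih =>
        intro he
        have h₁ := ih (by omega)
        have h₂ : f ⟨e, by omega⟩ < f ⟨e + 1, he⟩ := f.strictMono (by simp [Fin.lt_def])
        rw [Fin.lt_def] at h₂
        omega
    have h₁ := hlt d hd
    have h₂ := (f ⟨d, hd⟩).2
    have h₃ := h (f ⟨0, by omega⟩) (by omega)
    rw [getElem!_pos L _ (by omega), getElem!_pos L _ (by omega)] at h₃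
    have h₄ := hL.rel_get_of_le (a := ⟨(f ⟨0, by omega⟩ : ℕ) + d, by omega⟩) (b := f ⟨d, hd⟩)
      (by simpa [Fin.le_def] using h₁)
    have h₅ := hmem ⟨0, by omega⟩
    have h₆ := hmem ⟨d, hd⟩
    simp only [List.get_eq_getElem, Fin.getElem_fin] at h₄ h₅ h₆
    omega
  · intro h ℓ hℓ
    rw [getElem!_pos L _ hℓ, getElem!_pos L _ (by omega)]
    by_contra! hlt
    have hs : ((L.drop ℓ).take (d + 1)).Sublist
        (L.filter (fun y => L[ℓ] ≤ y ∧ y < L[ℓ] + g)) := by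
      have hself : ((L.drop ℓ).take (d + 1)).filter (fun y => L[ℓ] ≤ y ∧ y < L[ℓ] + g) =
          (L.drop ℓ).take (d + 1) := by
        rw [List.filter_eq_self]
        intro y hy
        obtain ⟨i, hi, rfl⟩ := List.getElem_of_mem hy
        simp only [List.length_take, List.length_drop] at hi
        simp only [List.getElem_take, List.getElem_drop, decide_eq_true_eq]
        have h₁ := hL.rel_get_of_le (a := ⟨ℓ, by omega⟩) (b := ⟨ℓ + i, by omega⟩)
          (by simp [Fin.le_def])
        have h₂ := hL.rel_get_of_le (a := ⟨ℓ + i, by omega⟩) (b := ⟨ℓ + d, by omega⟩)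
          (by simp [Fin.le_def]; omega)
        simp only [List.get_eq_getElem] at h₁ h₂
        omega
      rw [← hself]
      exact ((List.take_sublist _ _).trans (List.drop_sublist _ _)).filter _
    have h₁ := hs.length_le.trans (h _)
    rw [List.length_take, List.length_drop] at h₁
    omega

theorem gapCond_sort_iff (μ : Multiset ℕ) {d g : ℕ} (hg : 0 < g) :
    GapCond (μ.sort (· ≤ ·)) d g ↔ ∀ x, ∑ y ∈ Finset.Ico x (x + g), μ.count y ≤ d := by
  rw [gapCond_iff (Multiset.pairwise_sort μ (· ≤ ·)) hg]
  refine forall_congr' fun x => ?_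
  suffices h : ((μ.sort (· ≤ ·)).filter (fun y => x ≤ y ∧ y < x + g)).length =
      ∑ y ∈ Finset.Ico x (x + g), μ.count y by rw [h]
  rw [← Multiset.coe_card, ← Multiset.filter_coe (fun y => x ≤ y ∧ y < x + g), Multiset.sort_eq,
    ← Multiset.sum_count_eq_card (s := Finset.Ico x (x + g))]
  · refine Finset.sum_congr rfl fun y hy => ?_
    rw [Multiset.count_filter_of_pos (p := fun y => x ≤ y ∧ y < x + g) (Finset.mem_Ico.1 hy)]
  · intro y hy
    exact Finset.mem_Ico.2 (Multiset.mem_filter.1 hy).2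

theorem gapCond_sort_one_two_iff (μ : Multiset ℕ) :
    GapCond (μ.sort (· ≤ ·)) 1 2 ↔ ∀ x, μ.count x + μ.count (x + 1) ≤ 1 := by
  rw [gapCond_sort_iff μ Nat.two_pos]
  simp only [Finset.sum_Ico_eq_sum_range, Nat.add_sub_cancel_left, Finset.sum_range_succ,
    Finset.sum_range_zero, zero_add, add_zero]

theorem gapCond_sort_even_iff (μ : Multiset ℕ) :
    GapCond ((μ.filter (fun x => Even x)).sort (· ≤ ·)) 2 4 ↔
      ∀ x, μ.count (2 * x) + μ.count (2 * (x + 1)) ≤ 2 := by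
  rw [gapCond_sort_iff _ four_pos]
  have h : ∀ x, ∑ y ∈ Finset.Ico x (x + 4), (μ.filter (fun x => Even x)).count y =
      μ.count (2 * ((x + 1) / 2)) + μ.count (2 * ((x + 1) / 2 + 1)) := by
    intro x
    simp only [Finset.sum_Ico_eq_sum_range, Nat.add_sub_cancel_left, Finset.sum_range_succ,
      Finset.sum_range_zero, Multiset.count_filter]
    rcases Nat.even_or_odd' x with ⟨y, rfl | rfl⟩
    · have : (2 * y + 1) / 2 = y := by omega
      simp [this, parity_simps, mul_add]
    · have : (2 * y + 1 + 1) / 2 = y + 1 := by omega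
      simp [this, parity_simps, mul_add, add_assoc]
  constructor
  · intro H x
    have := H (2 * x)
    rw [h] at this
    have e : (2 * x + 1) / 2 = x := by omega
    rwa [e] at this
  · intro H x
    rw [h]
    exact H _

theorem card_partition_eq_sum {Q : Multiset ℕ → Prop} (hQ : ∀ μ, Q μ → ∀ x ∈ μ, 0 < x) (n : ℕ) :
    (Nat.card {p : n.Partition // Q p.parts} : ℤ) =
      ∑ m ∈ Finset.range (n + 1), coeff n (gf (wt 1) {μ | Q μ ∧ μ.card = m}) := by
  have himg : Nat.Partition.parts '' {p : n.Partition | Q p.parts} = {μ | Q μ ∧ μ.sum = n} := by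
    ext μ
    constructor
    · rintro ⟨p, hp, rfl⟩
      exact ⟨hp, p.parts_sum⟩
    · rintro ⟨h₁, h₂⟩
      exact ⟨⟨μ, fun {i} hi => hQ μ h₁ i hi, h₂⟩, h₁, rfl⟩
  have hfin : {μ | Q μ ∧ μ.sum = n}.Finite := himg ▸ Set.toFinite _
  have hcard : Nat.card {p : n.Partition // Q p.parts} = {μ | Q μ ∧ μ.sum = n}.ncard := by
    rw [← himg, Set.ncard_image_of_injective _ fun p p' h => Nat.Partition.ext h]
    rfl
  rw [hcard, ncard_eq_sum_fiber hfin Multiset.card (Finset.range (n + 1)), Nat.cast_sum]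
  · refine Finset.sum_congr rfl fun m _ => ?_
    rw [coeff_gf]
    congr 2
    ext μ
    simp only [wt, Set.mem_inter_iff, Set.mem_ofPred_eq, Set.mem_preimage, Set.mem_singleton_iff,
      one_mul]
    tauto
  · rintro μ ⟨h₁, h₂⟩
    have := Multiset.card_nsmul_le_sum (s := μ) (a := 1) fun x hx => hQ μ h₁ x hx
    rw [smul_eq_mul, mul_one] at this
    rw [Finset.mem_range]
    omega

end EvenOdd

/-- For all `n ≥ 0`, `k ≥ 1` and `i = 1` or `2`,
`P^{2k}_{2,i}(n) = B^{2k}_{2,i}(n)`. -/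
theorem Pbig2k_eq_Bbig2k (n k i : ℕ) (hk : 1 ≤ k) (hi : i = 1 ∨ i = 2) :
    Pbig2k k i n = Bbig2k k i n := by
  obtain ⟨k, rfl⟩ := Nat.exists_eq_add_of_le' hk
  rw [← Nat.cast_inj (R := ℤ)]
  unfold Pbig2k Bbig2k Nat.Partition.evenParts Nat.Partition.sortedParts
  have hP := EvenOdd.card_partition_eq_sum
    (Q := fun μ => (∀ x ∈ μ, 2 * (k + 1) ≤ x) ∧ μ.count (2 * (k + 1)) ≤ i - 1 ∧
      (∀ x ∈ μ, ¬ Even x → 2 * (μ.card + (k + 1)) ≤ x + 1) ∧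
      GapCond ((μ.filter (fun x => Even x)).sort (· ≤ ·)) 2 4)
    (fun μ h x hx => by have := h.1 x hx; omega) n
  have hB := EvenOdd.card_partition_eq_sum
    (Q := fun μ => (∀ x ∈ μ, 2 * (k + 1) ≤ x) ∧ μ.count (2 * (k + 1)) ≤ i - 1 ∧
      GapCond (μ.sort (· ≤ ·)) 1 2)
    (fun μ h x hx => by have := h.1 x hx; omega) n
  refine hP.trans (Eq.trans (Finset.sum_congr rfl fun m _ => congrArg _ ?_) hB.symm)
  have h₁ : {μ : Multiset ℕ | ((∀ x ∈ μ, 2 * (k + 1) ≤ x) ∧ μ.count (2 * (k + 1)) ≤ i - 1 ∧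
      (∀ x ∈ μ, ¬ Even x → 2 * (μ.card + (k + 1)) ≤ x + 1) ∧
      GapCond ((μ.filter (fun x => Even x)).sort (· ≤ ·)) 2 4) ∧ μ.card = m} =
      EvenOdd.evenOddSet (k + 1) (i - 1) m := by
    ext μ
    simp only [EvenOdd.evenOddSet, Set.mem_ofPred_eq, EvenOdd.gapCond_sort_even_iff]
    constructor
    · rintro ⟨⟨h₁, h₂, h₃, h₄⟩, rfl⟩
      exact ⟨h₁, h₂, h₃, h₄, rfl⟩
    · rintro ⟨h₁, h₂, h₃, h₄, rfl⟩
      exact ⟨⟨h₁, h₂, h₃, h₄⟩, rfl⟩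
  have h₂ : {μ : Multiset ℕ | ((∀ x ∈ μ, 2 * (k + 1) ≤ x) ∧ μ.count (2 * (k + 1)) ≤ i - 1 ∧
      GapCond (μ.sort (· ≤ ·)) 1 2) ∧ μ.card = m} =
      EvenOdd.gapSet 1 (2 * (k + 1)) (i - 1) m := by
    ext μ
    simp only [EvenOdd.gapSet, Set.mem_ofPred_eq, EvenOdd.gapCond_sort_one_two_iff, and_assoc]
  rw [h₁, h₂]
  rcases hi with rfl | rfl
  · rw [Nat.sub_self, EvenOdd.gapSet_zero_count]
    exact (EvenOdd.gf_evenOddSet_eq k m).1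
  · exact (EvenOdd.gf_evenOddSet_eq k m).2
end

section
/- For all integers k ≥ 1, m ≥ 0, n ≥ 0, and for i = 1 or i = 2, p^{2k}_{2,i}(m,n) = p^{2k+1}_{2,i}(m, n + m), where p^{2k}_{2,i}(m,n) counts partitions of n with exactly m parts, all parts at least 2k, at most i-1 parts equal to 2k, every odd part plus 1 at least 2(m+k), and even parts (in decreasing order) satisfying λ_{i_ℓ} - λ_{i_{ℓ+2}} ≥ 4, and p^{2k+1}_{2,i}(m,n') counts partitions of n' with exactly m parts, all parts at least 2k+1, at most i-1 parts equal to 2k+1, every even part at least 2(m+k), and odd parts (in decreasing order) satisfying λ_{j_ℓ} - λ_{j_{ℓ+2}} ≥ 4. -/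
/-- `p2k k i m n` = number of partitions of `n` with exactly `m` parts, all parts
at least `2k`, at most `i - 1` parts equal to `2k`, every odd part plus `1` at
least `2(m+k)`, and even parts (in decreasing order) satisfying
`λ_{i_ℓ} - λ_{i_{ℓ+2}} ≥ 4`. -/
noncomputable def p2k (k i m n : ℕ) : ℕ :=
  Nat.card {p : n.Partition //
    Multiset.card p.parts = m ∧
    (∀ x ∈ p.parts, 2 * k ≤ x) ∧
    Multiset.count (2 * k) p.parts ≤ i - 1 ∧
    (∀ x ∈ p.parts, ¬ Even x → 2 * (m + k) ≤ x + 1) ∧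
    GapCond p.evenParts 2 4}

theorem gapCond_map_succ (L : List ℕ) (d g : ℕ) :
    GapCond (L.map (· + 1)) d g ↔ GapCond L d g := by
  unfold GapCond
  rw [List.length_map]
  refine forall₂_congr fun l hl => ?_
  rw [getElem!_pos _ _ (by simpa using hl), getElem!_pos _ _ (by rw [List.length_map]; omega),
    getElem!_pos L _ hl, getElem!_pos L l (by omega), List.getElem_map, List.getElem_map,
    Nat.add_sub_add_right]

theorem sort_filter_odd_map_succ (s : Multiset ℕ) :
    ((s.map (· + 1)).filter (fun x => ¬ Even x)).sort (· ≤ ·) =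
      ((s.filter (fun x => Even x)).sort (· ≤ ·)).map (· + 1) := by
  rw [Multiset.filter_map, Multiset.map_sort (r := (· ≤ ·)) (r' := (· ≤ ·)) (hs := by simp)]
  congr 2
  exact Multiset.filter_congr fun x _ => by simp [Nat.odd_add_one]

/-- Adding `1` to every part. -/
def Nat.Partition.shift {n m : ℕ} (p : n.Partition) (hm : Multiset.card p.parts = m) :
    (n + m).Partition where
  parts := p.parts.map (· + 1)
  parts_pos h := by
    obtain ⟨x, -, rfl⟩ := Multiset.mem_map.1 h
    exact x.succ_pos
  parts_sum := by simp [Multiset.sum_map_add, p.parts_sum, hm]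

theorem Nat.Partition.exists_shift_eq {n m : ℕ} (q : (n + m).Partition)
    (hm : Multiset.card q.parts = m) (h : ∀ x ∈ q.parts, 2 ≤ x) :
    ∃ (p : n.Partition) (hp : Multiset.card p.parts = m), p.shift hp = q := by
  have hmap : (q.parts.map (· - 1)).map (· + 1) = q.parts := by
    rw [Multiset.map_map]
    refine (Multiset.map_congr rfl fun x hx => ?_).trans (Multiset.map_id _)
    have := h x hx
    simp only [Function.comp_apply, id]
    omega
  have hsum : (q.parts.map (· - 1)).sum = n := by
    have := congrArg Multiset.sum hmap
    rw [q.parts_sum, Multiset.sum_map_add] at this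
    simpa [hm] using this
  refine ⟨⟨q.parts.map (· - 1), fun hx => ?_, hsum⟩, by simpa using hm,
    Nat.Partition.ext hmap⟩
  obtain ⟨y, hy, rfl⟩ := Multiset.mem_map.1 hx
  have := h y hy
  omega

theorem Nat.Partition.shift_conditions_iff {n m : ℕ} (k i : ℕ) (p : n.Partition)
    (hm : Multiset.card p.parts = m) :
    (Multiset.card (p.shift hm).parts = m ∧
      (∀ x ∈ (p.shift hm).parts, 2 * k + 1 ≤ x) ∧
      Multiset.count (2 * k + 1) (p.shift hm).parts ≤ i - 1 ∧
      (∀ x ∈ (p.shift hm).parts, Even x → 2 * (m + k) ≤ x) ∧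
      GapCond (p.shift hm).oddParts 2 4) ↔
    (Multiset.card p.parts = m ∧
      (∀ x ∈ p.parts, 2 * k ≤ x) ∧
      Multiset.count (2 * k) p.parts ≤ i - 1 ∧
      (∀ x ∈ p.parts, ¬ Even x → 2 * (m + k) ≤ x + 1) ∧
      GapCond p.evenParts 2 4) := by
  have hgap : GapCond (p.shift hm).oddParts 2 4 ↔ GapCond p.evenParts 2 4 := by
    rw [← gapCond_map_succ p.evenParts]
    exact iff_of_eq (congrArg (GapCond · 2 4) (sort_filter_odd_map_succ p.parts))
  have hcount : Multiset.count (2 * k + 1) (p.shift hm).parts = Multiset.count (2 * k) p.parts :=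
    Multiset.count_map_eq_count' _ _ (add_left_injective 1) _
  rw [hgap, hcount]
  simp [Nat.Partition.shift, Nat.even_add_one]

/-- For all `k ≥ 1`, `m, n ≥ 0` and `i = 1` or `2`,
`p^{2k}_{2,i}(m,n) = p^{2k+1}_{2,i}(m, n + m)`. -/
theorem p2k_eq_p2k1_shift (k m n i : ℕ) (hk : 1 ≤ k) (hi : i = 1 ∨ i = 2) :
    p2k k i m n = p2k1 k i m (n + m) := by
  refine Nat.card_eq_of_bijective
    (fun p => ⟨p.1.shift p.2.1, (p.1.shift_conditions_iff k i p.2.1).2 p.2⟩) ⟨?_, ?_⟩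
  · intro p q h
    exact Subtype.ext <| Nat.Partition.ext <|
      Multiset.map_injective (add_left_injective 1) (congrArg (·.1.parts) h)
  · rintro ⟨q, hq⟩
    obtain ⟨p, hp, rfl⟩ := q.exists_shift_eq hq.1 fun x hx => by
      have := hq.2.1 x hx
      omega
    exact ⟨⟨p, (p.shift_conditions_iff k i hp).1 hq⟩, rfl⟩
end

section
/- For all integers k ≥ 1, m ≥ 0, n ≥ 0, and for i = 1 or i = 2, p^{2k}_{2,i}(m,n) = b^{2k}_{2,i}(m,n); that is, the number of partitions of n with exactly m parts, all parts at least 2k, at most i-1 parts equal to 2k, every odd part plus 1 at least 2(m+k), and even parts (in decreasing order) satisfying λ_{i_ℓ} - λ_{i_{ℓ+2}} ≥ 4, equals the number of partitions of n with exactly m parts, all parts at least 2k, at most i-1 parts equal to 2k, and any two parts differing by at least 2. -/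
/-- `b2k k i m n` = number of partitions of `n` with exactly `m` parts, all parts
at least `2k`, at most `i - 1` parts equal to `2k`, and any two parts differing
by at least `2`. -/
noncomputable def b2k (k i m n : ℕ) : ℕ :=
  Nat.card {p : n.Partition //
    Multiset.card p.parts = m ∧
    (∀ x ∈ p.parts, 2 * k ≤ x) ∧
    Multiset.count (2 * k) p.parts ≤ i - 1 ∧
    GapCond p.sortedParts 1 2}

/-- A list sorted increasingly satisfies `GapCond L d g` exactly when every window of length `g`
contains at most `d` of its entries. -/
theorem gapCond_iff_countP_le {L : List ℕ} (hL : L.Pairwise (· ≤ ·)) (d g : ℕ) (hg : 0 < g) :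
    GapCond L d g ↔ ∀ x, L.countP (fun y => x ≤ y ∧ y < x + g) ≤ d := by
  have mono : ∀ a b (_ : a ≤ b) (hb : b < L.length), L[a] ≤ L[b] := by
    intro a b hab hb
    rcases hab.eq_or_lt with rfl | h
    · exact le_rfl
    · exact List.pairwise_iff_getElem.1 hL a b _ _ h
  constructor
  · intro h x
    by_contra! hx
    rw [List.countP_eq_length_filter] at hx
    obtain ⟨f, hf⟩ := List.sublist_iff_exists_fin_orderEmbedding_get_eq.1
      (List.filter_sublist (l := L) (p := fun y => decide (x ≤ y ∧ y < x + g)))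
    have hmem : ∀ i, x ≤ L.get (f i) ∧ L.get (f i) < x + g := by
      intro i
      rw [← hf]
      simpa using (List.mem_filter.1 (List.get_mem _ i)).2
    have hge : ∀ j (hj : j < (L.filter (fun y => decide (x ≤ y ∧ y < x + g))).length),
        (f ⟨0, by omega⟩ : ℕ) + j ≤ f ⟨j, hj⟩ := by
      intro j
      induction j with
      | zero => intro hj; simp
      | succ j ih =>
        intro hj
        have h1 := ih (by omega)
        have h2 : f ⟨j, by omega⟩ < f ⟨j + 1, hj⟩ := f.strictMono (by simp)
        have h3 : (f ⟨j, by omega⟩ : ℕ) < f ⟨j + 1, hj⟩ := h2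
        omega
    have h0 := hmem ⟨0, by omega⟩
    have hd := hmem ⟨d, hx⟩
    have hlt := hge d hx
    have hlt' := (f ⟨d, hx⟩).2
    have := h (f ⟨0, by omega⟩) (by omega)
    rw [getElem!_pos L _ (by omega), getElem!_pos L _ (by omega)] at this
    have h4 := mono _ _ hlt hlt'
    simp only [List.get_eq_getElem] at h0 hd
    omega
  · intro h l hl
    rw [getElem!_pos L _ hl, getElem!_pos L _ (by omega)]
    by_contra! hlt
    have hsub : ((L.drop l).take (d + 1)).Sublist L :=
      (List.take_sublist _ _).trans (List.drop_sublist _ _)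
    have hc := (hsub.countP_le (p := fun y => decide (L[l] ≤ y ∧ y < L[l] + g))).trans (h L[l])
    have hall : ((L.drop l).take (d + 1)).countP (fun y => decide (L[l] ≤ y ∧ y < L[l] + g)) =
        ((L.drop l).take (d + 1)).length := by
      rw [List.countP_eq_length]
      intro y hy
      obtain ⟨i, hi, rfl⟩ := List.mem_iff_getElem.1 hy
      have hi' : i < d + 1 ∧ i < L.length - l := by simpa using hi
      rw [List.getElem_take, List.getElem_drop]
      have h1 := mono l (l + i) (by omega) (by omega)
      have h2 := mono (l + i) (l + d) (by omega) hl
      simp only [decide_eq_true_eq]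
      omega
    rw [hall] at hc
    simp only [List.length_take, List.length_drop] at hc
    omega

theorem gapCond_sort_iff (s : Multiset ℕ) (d g : ℕ) (hg : 0 < g) :
    GapCond (s.sort (· ≤ ·)) d g ↔ ∀ x, s.countP (fun y => x ≤ y ∧ y < x + g) ≤ d := by
  rw [gapCond_iff_countP_le (s.pairwise_sort _) d g hg]
  conv_rhs => rw [← s.sort_eq (· ≤ ·)]
  simp only [Multiset.coe_countP]

theorem gapCond_sort_one_two_iff (s : Multiset ℕ) :
    GapCond (s.sort (· ≤ ·)) 1 2 ↔ ∀ x, s.count x + s.count (x + 1) ≤ 1 := by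
  rw [gapCond_sort_iff s 1 2 two_pos]
  refine forall_congr' fun x => ?_
  suffices s.countP (fun y => x ≤ y ∧ y < x + 2) = s.count x + s.count (x + 1) by rw [this]
  induction s using Multiset.induction_on with
  | empty => simp
  | cons a s ih =>
    rw [Multiset.countP_cons, Multiset.count_cons, Multiset.count_cons, ih]
    split_ifs <;> omega

theorem gapCond_sort_filter_even_iff (s : Multiset ℕ) :
    GapCond ((s.filter (fun x => Even x)).sort (· ≤ ·)) 2 4 ↔
      ∀ x, Even x → s.count x + s.count (x + 2) ≤ 2 := by
  rw [gapCond_sort_iff _ 2 4 four_pos]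
  have key : ∀ x, Even x → ((s.filter (fun x => Even x)).countP (fun y => x ≤ y ∧ y < x + 4) =
        s.count x + s.count (x + 2)) ∧
      ((s.filter (fun x => Even x)).countP (fun y => x + 1 ≤ y ∧ y < x + 1 + 4) =
        s.count (x + 2) + s.count (x + 4)) := by
    intro x hx
    simp only [Multiset.countP_filter]
    induction s using Multiset.induction_on with
    | empty => simp
    | cons a s ih =>
      simp only [Multiset.countP_cons, Multiset.count_cons, ih]
      rw [Nat.even_iff] at hx
      simp only [Nat.even_iff]
      constructor <;> split_ifs <;> omega
  constructor
  · intro h x hx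
    rw [← (key x hx).1]
    exact h x
  · intro h x
    rcases Nat.even_or_odd x with hx | hx
    · rw [(key x hx).1]
      exact h x hx
    · obtain ⟨y, rfl⟩ := hx
      rw [(key (2 * y) (even_two_mul y)).2]
      exact h (2 * y + 2) ⟨y + 1, by ring⟩

/-- Multisets with `m` elements and sum `n`, all of whose elements are at least `e` and differ
pairwise by at least `2`. -/
def distantMultisets (e : ℕ) (m n : ℤ) : Set (Multiset ℕ) :=
  {s | (Multiset.card s : ℤ) = m ∧ (s.sum : ℤ) = n ∧ (∀ x ∈ s, e ≤ x) ∧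
    ∀ x, s.count x + s.count (x + 1) ≤ 1}

/-- Multisets with `m` elements and sum `n`, whose even elements are at least `e`, at most `j` of
them being equal to `e`, whose odd elements `x` satisfy `z ≤ x + 1`, and in which any two
consecutive even numbers occur at most twice in total. -/
def evenOddMultisets (e j : ℕ) (z m n : ℤ) : Set (Multiset ℕ) :=
  {s | (Multiset.card s : ℤ) = m ∧ (s.sum : ℤ) = n ∧ (∀ x ∈ s, Even x → e ≤ x) ∧
    s.count e ≤ j ∧ (∀ x ∈ s, ¬ Even x → z ≤ x + 1) ∧
    ∀ x, Even x → s.count x + s.count (x + 2) ≤ 2}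

theorem finite_multiset_card_sum (m n : ℤ) :
    {s : Multiset ℕ | (Multiset.card s : ℤ) = m ∧ (s.sum : ℤ) = n}.Finite := by
  refine Set.Finite.subset (Multiset.finite_toSet
    (Multiset.powerset (m.toNat • Multiset.range (n.toNat + 1)))) ?_
  rintro s ⟨h1, h2⟩
  simp only [Set.mem_ofPred_eq, Multiset.mem_powerset]
  rw [Multiset.le_iff_count]
  intro a
  by_cases ha : a ∈ s
  · have h3 := Multiset.le_sum_of_mem ha
    have h4 : 1 ≤ (Multiset.range (n.toNat + 1)).count a :=
      Multiset.one_le_count_iff_mem.2 (Multiset.mem_range.2 (by omega))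
    have h5 := Multiset.count_le_card a s
    rw [Multiset.count_nsmul]
    nlinarith [show Multiset.card s = m.toNat by omega]
  · simp [Multiset.count_eq_zero_of_notMem ha]

theorem finite_distantMultisets (e : ℕ) (m n : ℤ) : (distantMultisets e m n).Finite :=
  (finite_multiset_card_sum m n).subset fun _ hs => ⟨hs.1, hs.2.1⟩

theorem finite_evenOddMultisets (e j : ℕ) (z m n : ℤ) : (evenOddMultisets e j z m n).Finite :=
  (finite_multiset_card_sum m n).subset fun _ hs => ⟨hs.1, hs.2.1⟩

theorem ncard_eq_add_of_mem_iff {S S' T : Set (Multiset ℕ)} (hS : S.Finite) (u : Multiset ℕ)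
    (hle : ∀ s, s ∈ S' → ¬ u ≤ s) (h : ∀ s, ¬ u ≤ s → (s ∈ S ↔ s ∈ S'))
    (hu : ∀ t, u + t ∈ S ↔ t ∈ T) : S.ncard = S'.ncard + T.ncard := by
  have hST : S = S' ∪ (u + ·) '' T := by
    ext s
    by_cases hs : u ≤ s
    · obtain ⟨t, rfl⟩ := Multiset.le_iff_exists_add.1 hs
      simp only [hu, Set.mem_union, Set.mem_image, add_right_inj, exists_eq_right]
      exact ⟨Or.inr, fun h' => h'.resolve_left fun h'' => hle _ h'' hs⟩
    · rw [h s hs, Set.mem_union]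
      refine ⟨Or.inl, fun h' => h'.resolve_right ?_⟩
      rintro ⟨t, -, rfl⟩
      exact hs (Multiset.le_add_right _ _)
  have hdisj : Disjoint S' ((u + ·) '' T) := by
    rw [Set.disjoint_left]
    rintro _ hs ⟨t, -, rfl⟩
    exact hle _ hs (Multiset.le_add_right _ _)
  rw [hST] at hS ⊢
  rw [Set.ncard_union_eq hdisj (hS.subset Set.subset_union_left)
    (hS.subset Set.subset_union_right), Set.ncard_image_of_injective _ (add_right_injective u)]

theorem ncard_distantMultisets_split (e : ℕ) (m n : ℤ) :
    (distantMultisets e m n).ncard =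
      (distantMultisets (e + 1) m n).ncard + (distantMultisets (e + 2) (m - 1) (n - e)).ncard := by
  refine ncard_eq_add_of_mem_iff (finite_distantMultisets _ _ _) {e} ?_ ?_ ?_
  · rintro s ⟨-, -, h, -⟩ hs
    have := h e (Multiset.singleton_le.1 hs)
    omega
  · intro s hs
    rw [Multiset.singleton_le] at hs
    refine and_congr_right fun _ => and_congr_right fun _ => and_congr_left fun _ =>
      forall₂_congr fun x hx => ?_
    have : x ≠ e := fun h => hs (h ▸ hx)
    omega
  · intro t
    simp only [distantMultisets, Set.mem_ofPred_eq, Multiset.card_add, Multiset.card_singleton,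
      Multiset.sum_add, Multiset.sum_singleton, Multiset.count_add, Multiset.count_singleton,
      Multiset.mem_add, Multiset.mem_singleton]
    push_cast
    refine and_congr (by omega) (and_congr (by omega) ⟨?_, ?_⟩)
    · rintro ⟨h1, h2⟩
      refine ⟨fun x hx => ?_, fun x => ?_⟩
      · have h3 := h1 x (Or.inr hx)
        have h4 := h2 e
        have h5 := Multiset.one_le_count_iff_mem.2 hx
        by_contra! hlt
        obtain rfl | rfl : x = e ∨ x = e + 1 := by omega
        · simp at h4; omega
        · simp at h4; omega
      · have := h2 x
        omega
    · rintro ⟨h1, h2⟩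
      have hz : ∀ y, y < e + 2 → t.count y = 0 := fun y hy =>
        Multiset.count_eq_zero.2 fun hm => by have := h1 y hm; omega
      refine ⟨?_, fun x => ?_⟩
      · rintro x (rfl | hx)
        · exact le_rfl
        · have := h1 x hx
          omega
      · have h3 := h2 x
        have h4 := hz x
        have h5 := hz (x + 1)
        split_ifs <;> omega

theorem ncard_distantMultisets_add (e d : ℕ) (m n : ℤ) :
    (distantMultisets (e + d) m n).ncard = (distantMultisets e m (n - d * m)).ncard := by
  have hinj : Function.Injective (fun x : ℕ => x + d) := add_left_injective d
  rw [← Set.ncard_image_of_injective (distantMultisets e m _) (Multiset.map_injective hinj)]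
  congr 1
  ext s
  have hmem : ∀ t : Multiset ℕ, t.map (· + d) ∈ distantMultisets (e + d) m n ↔
      t ∈ distantMultisets e m (n - d * m) := by
    intro t
    have hsum : (t.map (· + d)).sum = t.sum + Multiset.card t * d := by
      simp [Multiset.sum_map_add]
    have hcount : ∀ x, (t.map (· + d)).count (x + d) = t.count x := fun x =>
      Multiset.count_map_eq_count' _ t hinj x
    have hzero : ∀ x, x < d → (t.map (· + d)).count x = 0 := fun x hx => by
      rw [Multiset.count_eq_zero, Multiset.mem_map]
      rintro ⟨y, -, rfl⟩
      omega
    simp only [distantMultisets, Set.mem_ofPred_eq, Multiset.card_map, hsum]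
    push_cast
    refine and_congr_right fun hm => and_congr ?_ (and_congr ?_ ⟨fun h x => ?_, fun h x => ?_⟩)
    · rw [hm, mul_comm (d : ℤ)]
      constructor <;> intro h <;> linarith
    · simp
    · have := h (x + d)
      rwa [add_right_comm, hcount, hcount] at this
    · by_cases hx : d ≤ x
      · obtain ⟨y, rfl⟩ := Nat.exists_eq_add_of_le' hx
        rw [add_right_comm, hcount, hcount]
        exact h y
      · rw [hzero x (by omega), zero_add]
        by_cases hx' : d ≤ x + 1
        · obtain ⟨y, hy⟩ := Nat.exists_eq_add_of_le' hx'
          rw [hy, hcount]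
          have := h y
          omega
        · rw [hzero _ (by omega)]
          omega
  constructor
  · intro hs
    have hback : (s.map (· - d)).map (· + d) = s := by
      rw [Multiset.map_map]
      conv_rhs => rw [← Multiset.map_id s]
      refine Multiset.map_congr rfl fun x hx => ?_
      have := hs.2.2.1 x hx
      simp only [Function.comp, id]
      omega
    exact ⟨s.map (· - d), (hmem _).1 (hback.symm ▸ hs), hback⟩
  · rintro ⟨t, ht, rfl⟩
    exact (hmem t).2 ht

theorem ncard_evenOddMultisets_split_one {e : ℕ} (he : Even e) (z m n : ℤ) :
    (evenOddMultisets e 1 z m n).ncard = (evenOddMultisets (e + 2) 2 z m n).ncard +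
      (evenOddMultisets (e + 2) 1 z (m - 1) (n - e)).ncard := by
  rw [Nat.even_iff] at he
  refine ncard_eq_add_of_mem_iff (finite_evenOddMultisets _ _ _ _ _) {e} ?_ ?_ ?_
  · rintro s ⟨-, -, h, -⟩ hs
    have := h e (Multiset.singleton_le.1 hs) (Nat.even_iff.2 he)
    omega
  · intro s hs
    rw [Multiset.singleton_le] at hs
    have h0 := Multiset.count_eq_zero.2 hs
    simp only [evenOddMultisets, Set.mem_ofPred_eq, Nat.even_iff]
    refine and_congr_right fun _ => and_congr_right fun _ => ⟨?_, ?_⟩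
    · rintro ⟨h1, h2, h3, h4⟩
      refine ⟨fun x hx hx' => ?_, ?_, h3, h4⟩
      · have := h1 x hx hx'
        have : x ≠ e := fun h => hs (h ▸ hx)
        omega
      · have := h4 e he
        omega
    · rintro ⟨h1, h2, h3, h4⟩
      refine ⟨fun x hx hx' => ?_, ?_, h3, h4⟩
      · have := h1 x hx hx'
        omega
      · omega
  · intro t
    simp only [evenOddMultisets, Set.mem_ofPred_eq, Multiset.card_add, Multiset.card_singleton,
      Multiset.sum_add, Multiset.sum_singleton, Multiset.count_add, Multiset.count_singleton,
      Multiset.mem_add, Multiset.mem_singleton, Nat.even_iff]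
    push_cast
    refine and_congr (by omega) (and_congr (by omega) ⟨?_, ?_⟩)
    · rintro ⟨h1, h2, h3, h4⟩
      have h0 : t.count e = 0 := by omega
      refine ⟨fun x hx hx' => ?_, ?_, fun x hx => h3 x (Or.inr hx), fun x hx => ?_⟩
      · have := h1 x (Or.inr hx) hx'
        have : x ≠ e := fun h => Multiset.count_eq_zero.1 h0 (h ▸ hx)
        omega
      · have := h4 e he
        simp at this
        omega
      · have := h4 x hx
        omega
    · rintro ⟨h1, h2, h3, h4⟩
      have hz : ∀ y, y < e + 2 → y % 2 = 0 → t.count y = 0 := fun y hy hy' =>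
        Multiset.count_eq_zero.2 fun hm => by have := h1 y hm hy'; omega
      refine ⟨?_, ?_, ?_, fun x hx => ?_⟩
      · rintro x (rfl | hx) hx'
        · exact le_rfl
        · have := h1 x hx hx'
          omega
      · simp [hz e (by omega) he]
      · rintro x (rfl | hx) hx'
        · omega
        · exact h3 x hx hx'
      · have h5 := h4 x hx
        have h6 := hz x
        have h7 := hz (x + 2)
        by_cases hxe : x = e
        · subst hxe
          simp
          omega
        · split_ifs <;> omega

theorem ncard_evenOddMultisets_split_two {e : ℕ} (he : Even e) (z m n : ℤ) :
    (evenOddMultisets e 2 z m n).ncard = (evenOddMultisets e 1 z m n).ncard +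
      (evenOddMultisets (e + 4) 2 z (m - 2) (n - 2 * e)).ncard := by
  rw [Nat.even_iff] at he
  have hle : ∀ s : Multiset ℕ, Multiset.replicate 2 e ≤ s ↔ 2 ≤ s.count e := fun s =>
    Multiset.le_count_iff_replicate_le.symm
  refine ncard_eq_add_of_mem_iff (finite_evenOddMultisets _ _ _ _ _) (Multiset.replicate 2 e)
    ?_ ?_ ?_
  · rintro s ⟨-, -, -, h, -⟩
    rw [hle]
    omega
  · intro s
    rw [hle]
    intro hs
    refine and_congr_right fun _ => and_congr_right fun _ => and_congr_right fun _ =>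
      and_congr_left fun _ => by omega
  · intro t
    simp only [evenOddMultisets, Set.mem_ofPred_eq, Multiset.card_add, Multiset.card_replicate,
      Multiset.sum_add, Multiset.sum_replicate, Multiset.count_add, Multiset.count_replicate,
      Multiset.mem_add, Multiset.mem_replicate, Nat.even_iff, smul_eq_mul]
    push_cast
    refine and_congr (by omega) (and_congr (by omega) ⟨?_, ?_⟩)
    · rintro ⟨h1, h2, h3, h4⟩
      have h5 := h4 e he
      have h6 := h4 (e + 4) (by omega)
      simp only [if_true] at h2 h5
      refine ⟨fun x hx hx' => ?_, ?_, fun x hx => h3 x (Or.inr hx), fun x hx => ?_⟩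
      · have := h1 x (Or.inr hx) hx'
        have h7 := Multiset.one_le_count_iff_mem.2 hx
        by_contra! hlt
        obtain rfl | rfl : x = e ∨ x = e + 2 := by omega
        · omega
        · omega
      · omega
      · have := h4 x hx
        omega
    · rintro ⟨h1, h2, h3, h4⟩
      have hz : ∀ y, y < e + 4 → y % 2 = 0 → t.count y = 0 := fun y hy hy' =>
        Multiset.count_eq_zero.2 fun hm => by have := h1 y hm hy'; omega
      refine ⟨?_, ?_, ?_, fun x hx => ?_⟩
      · rintro x (⟨-, rfl⟩ | hx) hx'
        · exact le_rfl
        · have := h1 x hx hx'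
          omega
      · simp [hz e (by omega) he]
      · rintro x (⟨-, rfl⟩ | hx) hx'
        · omega
        · exact h3 x hx hx'
      · have h5 := h4 x hx
        have h6 := hz x
        have h7 := hz (x + 2)
        split_ifs <;> omega

theorem ncard_evenOddMultisets_split_odd {a : ℕ} (ha : ¬ Even a) {e : ℕ} (he : Even e) (j : ℕ)
    (m n : ℤ) :
    (evenOddMultisets e j (a + 1) m n).ncard = (evenOddMultisets e j (a + 3) m n).ncard +
      (evenOddMultisets e j (a + 1) (m - 1) (n - a)).ncard := by
  rw [Nat.even_iff] at ha he
  refine ncard_eq_add_of_mem_iff (finite_evenOddMultisets _ _ _ _ _) {a} ?_ ?_ ?_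
  · rintro s ⟨-, -, -, -, h, -⟩ hs
    have := h a (Multiset.singleton_le.1 hs) (by rwa [Nat.even_iff])
    omega
  · intro s hs
    rw [Multiset.singleton_le] at hs
    simp only [evenOddMultisets, Set.mem_ofPred_eq, Nat.even_iff]
    refine and_congr_right fun _ => and_congr_right fun _ => and_congr_right fun _ =>
      and_congr_right fun _ => and_congr_left fun _ => forall₂_congr fun x hx => ?_
    have : x ≠ a := fun h => hs (h ▸ hx)
    omega
  · intro t
    simp only [evenOddMultisets, Set.mem_ofPred_eq, Multiset.card_add, Multiset.card_singleton,
      Multiset.sum_add, Multiset.sum_singleton, Multiset.count_add, Multiset.count_singleton,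
      Multiset.mem_add, Multiset.mem_singleton, Nat.even_iff, forall_eq_or_imp]
    push_cast
    refine and_congr (by omega) (and_congr (by omega) (and_congr ?_ (and_congr ?_
      (and_congr ?_ (forall₂_congr fun x hx => ?_)))))
    · simp [ha]
    · rw [if_neg (by rintro rfl; omega), zero_add]
    · simp
    · rw [if_neg (by rintro rfl; omega), if_neg (by rintro rfl; omega), zero_add, zero_add]

theorem evenOddMultisets_eq_distantMultisets_of_nonpos {m : ℤ} (hm : m ≤ 0) (e e' j : ℕ)
    (z n : ℤ) : evenOddMultisets e j z m n = distantMultisets e' m n := by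
  ext s
  simp only [evenOddMultisets, distantMultisets, Set.mem_ofPred_eq]
  refine and_congr_right fun h => and_congr_right fun _ => ?_
  obtain rfl : s = 0 := Multiset.card_eq_zero.1 (by omega)
  simp

theorem distantMultisets_eq_empty {e : ℕ} {m n : ℤ} (hm : 0 < m) (hn : n < e) :
    distantMultisets e m n = ∅ := by
  rw [Set.eq_empty_iff_forall_notMem]
  rintro s ⟨h1, h2, h3, -⟩
  obtain ⟨x, hx⟩ := Multiset.card_pos_iff_exists_mem.1 (show 0 < Multiset.card s by omega)
  have := h3 x hx
  have := Multiset.le_sum_of_mem hx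
  omega

theorem evenOddMultisets_eq_empty {e j : ℕ} {z m n : ℤ} (hm : 0 < m) (hn : n < e)
    (hz : n + 1 < z) : evenOddMultisets e j z m n = ∅ := by
  rw [Set.eq_empty_iff_forall_notMem]
  rintro s ⟨h1, h2, h3, -, h4, -⟩
  obtain ⟨x, hx⟩ := Multiset.card_pos_iff_exists_mem.1 (show 0 < Multiset.card s by omega)
  have := Multiset.le_sum_of_mem hx
  by_cases hx' : Even x
  · have := h3 x hx hx'
    omega
  · have := h4 x hx hx'
    omega

theorem ncard_evenOddMultisets_eq (m : ℤ) (k : ℕ) (n : ℤ) :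
    (evenOddMultisets (2 * k) 1 (2 * (m + k)) m n).ncard = (distantMultisets (2 * k) m n).ncard ∧
    (evenOddMultisets (2 * k + 2) 2 (2 * (m + k)) m n).ncard =
      (distantMultisets (2 * k + 1) m n).ncard := by
  obtain ⟨M, hM⟩ : ∃ M : ℕ, m ≤ M := ⟨m.toNat, Int.self_le_toNat m⟩
  induction M using Nat.strong_induction_on generalizing m k n with
  | _ M ihM =>
  rcases le_or_gt m 0 with hm | hm
  · rw [evenOddMultisets_eq_distantMultisets_of_nonpos hm _ (2 * k),
      evenOddMultisets_eq_distantMultisets_of_nonpos hm _ (2 * k + 1)]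
    exact ⟨rfl, rfl⟩
  have ih : ∀ m' : ℤ, m' < m → ∀ (k : ℕ) (n : ℤ), _ := fun m' hm' k n =>
    ihM (M - 1) (by omega) m' k n (by omega)
  clear ihM hM
  obtain ⟨N, hN⟩ : ∃ N : ℕ, n < 2 * k + N := ⟨(n + 1).toNat, by omega⟩
  induction N generalizing k with
  | zero =>
    rw [evenOddMultisets_eq_empty hm, evenOddMultisets_eq_empty hm,
      distantMultisets_eq_empty hm, distantMultisets_eq_empty hm]
    · exact ⟨rfl, rfl⟩
    all_goals push_cast; omega
  | succ N ihN =>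
    have hA : (evenOddMultisets (2 * k + 2) 2 (2 * (m + k)) m n).ncard =
        (distantMultisets (2 * k + 1) m n).ncard := by
      obtain ⟨a, ha⟩ : ∃ a : ℕ, (a : ℤ) + 1 = 2 * (m + k) := ⟨(2 * (m + k) - 1).toNat, by omega⟩
      have ha' : ¬ Even a := by rw [Nat.even_iff]; omega
      have h1 := ncard_evenOddMultisets_split_two (e := 2 * k + 2) ⟨k + 1, by ring⟩
        (2 * (m + k)) m n
      have h2 := ncard_evenOddMultisets_split_odd ha' (e := 2 * k + 2) ⟨k + 1, by ring⟩ 1 m n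
      have h3 := (ihN (k + 1) (by push_cast at hN ⊢; omega)).1
      have h4 := (ih (m - 1) (by omega) (k + 1) (n - a)).1
      have h5 := (ih (m - 2) (by omega) (k + 2) (n - 2 * (2 * k + 2))).2
      have h6 := ncard_distantMultisets_split (2 * k + 1) m n
      have h7 := ncard_distantMultisets_split (2 * k + 3) (m - 1) (n - (2 * k + 1))
      have h8 := ncard_distantMultisets_add (2 * k + 2) 2 (m - 1) (n - (2 * k + 1))
      rw [ha, show (a : ℤ) + 3 = 2 * (m + (k + 1)) by omega] at h2
      push_cast at h1 h3 h4 h5 h6 h7 h8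
      rw [show m - 1 + ((k : ℤ) + 1) = m + k by ring, show 2 * (k + 1) = 2 * k + 2 by ring] at h4
      rw [show m - 2 + ((k : ℤ) + 2) = m + k by ring,
        show 2 * (k + 2) + 2 = 2 * k + 2 + 4 by ring,
        show 2 * (k + 2) + 1 = 2 * k + 5 by ring] at h5
      rw [show 2 * (k + 1) = 2 * k + 2 by ring] at h3
      rw [show n - (2 * (k : ℤ) + 1) - 2 * (m - 1) = n - a by linarith] at h8
      rw [show n - (2 * (k : ℤ) + 1) - (2 * k + 3) = n - 2 * (2 * k + 2) by ring,
        show m - 1 - 1 = m - 2 by ring] at h7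
      rw [show 2 * k + 3 + 1 = 2 * k + 2 + 2 by ring, show 2 * k + 3 + 2 = 2 * k + 5 by ring] at h7
      rw [show 2 * k + 1 + 1 = 2 * k + 2 by ring, show 2 * k + 1 + 2 = 2 * k + 3 by ring] at h6
      omega
    refine ⟨?_, hA⟩
    have h1 := ncard_evenOddMultisets_split_one (even_two_mul k) (2 * (m + k)) m n
    have h2 := (ih (m - 1) (by omega) (k + 1) (n - (2 * k : ℕ))).1
    have h3 := ncard_distantMultisets_split (2 * k) m n
    push_cast at h1 h2 h3
    rw [show m - 1 + ((k : ℤ) + 1) = m + k by ring, show 2 * (k + 1) = 2 * k + 2 by ring] at h2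
    omega

theorem card_partition_subtype_eq_ncard {n : ℕ} {P : n.Partition → Prop} {S : Set (Multiset ℕ)}
    (hS : ∀ s ∈ S, s.sum = n ∧ ∀ x ∈ s, 0 < x) (h : ∀ p : n.Partition, P p ↔ p.parts ∈ S) :
    Nat.card {p : n.Partition // P p} = S.ncard := by
  rw [← Nat.card_coe_set_eq]
  refine Nat.card_congr
    { toFun := fun p => ⟨p.1.parts, (h p.1).1 p.2⟩
      invFun := fun s => ⟨⟨s.1, fun {x} hx => (hS s.1 s.2).2 x hx, (hS s.1 s.2).1⟩, (h _).2 s.2⟩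
      left_inv := fun p => rfl
      right_inv := fun s => rfl }

theorem forall_mem_le_and_count_iff {s : Multiset ℕ} {a : ℕ} :
    ((∀ x ∈ s, a ≤ x) ∧ s.count a ≤ 0) ↔ ∀ x ∈ s, a + 1 ≤ x := by
  rw [Nat.le_zero, Multiset.count_eq_zero]
  constructor
  · rintro ⟨h1, h2⟩ x hx
    exact lt_of_le_of_ne (h1 x hx) fun h => h2 (h ▸ hx)
  · intro h
    exact ⟨fun x hx => (Nat.le_succ a).trans (h x hx), fun ha => absurd (h a ha) (by omega)⟩

theorem b2k_one (k m n : ℕ) : b2k k 1 m n = (distantMultisets (2 * k + 1) m n).ncard := by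
  refine card_partition_subtype_eq_ncard ?_ fun p => ?_
  · rintro s ⟨-, h2, h3, -⟩
    exact ⟨by exact_mod_cast h2, fun x hx => by have := h3 x hx; omega⟩
  · simp only [distantMultisets, Set.mem_ofPred_eq, Nat.cast_inj, p.parts_sum, true_and,
      Nat.Partition.sortedParts, gapCond_sort_one_two_iff, ← forall_mem_le_and_count_iff,
      Nat.sub_self, and_assoc]

theorem b2k_two {k : ℕ} (hk : 1 ≤ k) (m n : ℕ) :
    b2k k 2 m n = (distantMultisets (2 * k) m n).ncard := by
  refine card_partition_subtype_eq_ncard ?_ fun p => ?_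
  · rintro s ⟨-, h2, h3, -⟩
    exact ⟨by exact_mod_cast h2, fun x hx => by have := h3 x hx; omega⟩
  · simp only [distantMultisets, Set.mem_ofPred_eq, Nat.cast_inj, p.parts_sum, true_and,
      Nat.Partition.sortedParts, gapCond_sort_one_two_iff]
    refine and_congr_right fun _ => and_congr_right fun _ => and_iff_right_of_imp fun h => ?_
    have := h (2 * k)
    omega

theorem p2k_one (k m n : ℕ) :
    p2k k 1 m n = (evenOddMultisets (2 * k + 2) 2 (2 * (m + k)) m n).ncard := by
  refine card_partition_subtype_eq_ncard ?_ fun p => ?_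
  · rintro s ⟨-, h2, h3, -, -, -⟩
    refine ⟨by exact_mod_cast h2, fun x hx => Nat.pos_of_ne_zero ?_⟩
    rintro rfl
    have := h3 0 hx Even.zero
    omega
  · simp only [evenOddMultisets, Set.mem_ofPred_eq, Nat.cast_inj, p.parts_sum, true_and,
      Nat.Partition.evenParts, gapCond_sort_filter_even_iff, Nat.sub_self]
    refine and_congr_right fun hm => ?_
    constructor
    · rintro ⟨h1, h2, h3, h4⟩
      have h5 := forall_mem_le_and_count_iff.1 ⟨h1, h2⟩
      refine ⟨fun x hx hx' => ?_, ?_, fun x hx hx' => by exact_mod_cast h3 x hx hx', h4⟩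
      · have := h5 x hx
        rw [Nat.even_iff] at hx'
        omega
      · have := h4 (2 * k + 2) ⟨k + 1, by ring⟩
        omega
    · rintro ⟨h1, -, h3, h4⟩
      rw [← and_assoc, forall_mem_le_and_count_iff]
      refine ⟨fun x hx => ?_, fun x hx hx' => by exact_mod_cast h3 x hx hx', h4⟩
      have hpos := Multiset.card_pos_iff_exists_mem.2 ⟨x, hx⟩
      by_cases hx' : Even x
      · have := h1 x hx hx'
        omega
      · have := h3 x hx hx'
        omega

theorem p2k_two {k : ℕ} (hk : 1 ≤ k) (m n : ℕ) :
    p2k k 2 m n = (evenOddMultisets (2 * k) 1 (2 * (m + k)) m n).ncard := by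
  refine card_partition_subtype_eq_ncard ?_ fun p => ?_
  · rintro s ⟨-, h2, h3, -, -, -⟩
    refine ⟨by exact_mod_cast h2, fun x hx => Nat.pos_of_ne_zero ?_⟩
    rintro rfl
    have := h3 0 hx Even.zero
    omega
  · simp only [evenOddMultisets, Set.mem_ofPred_eq, Nat.cast_inj, p.parts_sum, true_and,
      Nat.Partition.evenParts, gapCond_sort_filter_even_iff]
    refine and_congr_right fun hm => ?_
    constructor
    · rintro ⟨h1, h2, h3, h4⟩
      exact ⟨fun x hx _ => h1 x hx, h2, fun x hx hx' => by exact_mod_cast h3 x hx hx', h4⟩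
    · rintro ⟨h1, h2, h3, h4⟩
      refine ⟨fun x hx => ?_, h2, fun x hx hx' => by exact_mod_cast h3 x hx hx', h4⟩
      have hpos := Multiset.card_pos_iff_exists_mem.2 ⟨x, hx⟩
      by_cases hx' : Even x
      · exact h1 x hx hx'
      · have := h3 x hx hx'
        omega

/-- For all `k ≥ 1`, `m, n ≥ 0` and `i = 1` or `2`,
`p^{2k}_{2,i}(m,n) = b^{2k}_{2,i}(m,n)`. -/
theorem p2k_eq_b2k (k m n i : ℕ) (hk : 1 ≤ k) (hi : i = 1 ∨ i = 2) :
    p2k k i m n = b2k k i m n := by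
  rcases hi with rfl | rfl
  · rw [p2k_one, b2k_one]
    exact (ncard_evenOddMultisets_eq m k n).2
  · rw [p2k_two hk, b2k_two hk]
    exact (ncard_evenOddMultisets_eq m k n).1
end

section
/- For all integers k ≥ 1, m ≥ 1, and n ≥ 2m + 2k - 1, p^{2k+1}_{2,2}(m,n) - p^{2k+1}_{2,1}(m,n) = p^{2k+1}_{2,2}(m-1, n - 2m - 2k + 1), where p^{2k+1}_{2,i}(m,n) counts partitions of n with exactly m parts, all parts at least 2k+1, at most i-1 parts equal to 2k+1, every even part at least 2(m+k), and odd parts (in decreasing order) satisfying λ_{j_ℓ} - λ_{j_{ℓ+2}} ≥ 4. -/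
/-- The conditions counted by `p2k1 k i m n`, stated for a multiset of parts. -/
def IsP2k1Parts (k i m n : ℕ) (s : Multiset ℕ) : Prop :=
  s.sum = n ∧ Multiset.card s = m ∧ (∀ x ∈ s, 2 * k + 1 ≤ x) ∧
    Multiset.count (2 * k + 1) s ≤ i - 1 ∧ (∀ x ∈ s, Even x → 2 * (m + k) ≤ x) ∧
    GapCond ((s.filter (fun x => ¬ Even x)).sort (· ≤ ·)) 2 4

theorem image_parts_eq_setOf_isP2k1Parts (k i m n : ℕ) :
    Nat.Partition.parts '' {p : n.Partition |
      Multiset.card p.parts = m ∧ (∀ x ∈ p.parts, 2 * k + 1 ≤ x) ∧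
      Multiset.count (2 * k + 1) p.parts ≤ i - 1 ∧
      (∀ x ∈ p.parts, Even x → 2 * (m + k) ≤ x) ∧ GapCond p.oddParts 2 4} =
    {s | IsP2k1Parts k i m n s} := by
  ext s
  constructor
  · rintro ⟨p, hp, rfl⟩
    exact ⟨p.parts_sum, hp⟩
  · rintro ⟨hsum, hs⟩
    exact ⟨⟨s, fun {x} hx => by have := hs.2.1 x hx; omega, hsum⟩, hs, rfl⟩

theorem finite_setOf_isP2k1Parts (k i m n : ℕ) : {s | IsP2k1Parts k i m n s}.Finite := by
  rw [← image_parts_eq_setOf_isP2k1Parts]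
  exact (Set.toFinite _).image _

theorem p2k1_eq_ncard (k i m n : ℕ) : p2k1 k i m n = {s | IsP2k1Parts k i m n s}.ncard := by
  rw [← image_parts_eq_setOf_isP2k1Parts,
    Set.ncard_image_of_injective _ fun p q h => Nat.Partition.ext h]
  rfl

theorem gapCond_cons (a : ℕ) (L : List ℕ) (d g : ℕ) :
    GapCond (a :: L) (d + 1) g ↔ (d < L.length → g ≤ L[d]! - a) ∧ GapCond L (d + 1) g := by
  constructor
  · refine fun h => ⟨fun hd => ?_, fun l hl => ?_⟩
    · simpa using h 0 (by simpa using hd)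
    · simpa [Nat.add_right_comm l 1] using h (l + 1) (by simp; omega)
  · rintro ⟨h₀, h⟩ (_ | l) hl
    · simpa using h₀ (by simpa using hl)
    · simpa [Nat.add_right_comm l 1] using h l (by simp at hl; omega)

theorem add_two_le_getElem_one_iff_count_le_one {a : ℕ} {L : List ℕ} (ha : ¬ Even a)
    (hL : L.Pairwise (· ≤ ·)) (hodd : ∀ x ∈ L, ¬ Even x) (hle : ∀ x ∈ L, a ≤ x) :
    (1 < L.length → a + 2 ≤ L[1]!) ↔ L.count a ≤ 1 := by
  match L with
  | [] => simp
  | [x] => simpa using List.count_le_length (a := a) (l := [x])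
  | x :: y :: t =>
    simp only [List.pairwise_cons, List.mem_cons, forall_eq_or_imp] at hL hodd hle
    obtain ⟨⟨hxy, -⟩, hyt, -⟩ := hL
    have hy : y = a ∨ a + 2 ≤ y := by grind
    rcases hy with rfl | hy
    · obtain rfl : x = y := le_antisymm hxy hle.1
      simp
    · have ht : t.count a = 0 := List.count_eq_zero.2 fun h => by
        have := hyt a h
        omega
      have hya : y ≠ a := by omega
      have := List.count_le_length (a := a) (l := [x])
      simp only [List.count_cons] at this ⊢
      simp_all

theorem gapCond_cons_map_add_two {a : ℕ} {s : Multiset ℕ} (ha : ¬ Even a) (hs : ∀ x ∈ s, a ≤ x) :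
    GapCond (((a ::ₘ s.map (· + 2)).filter (fun x => ¬ Even x)).sort (· ≤ ·)) 2 4 ↔
      GapCond ((s.filter (fun x => ¬ Even x)).sort (· ≤ ·)) 2 4 ∧ s.count a ≤ 1 := by
  set L := (s.filter (fun x => ¬ Even x)).sort (· ≤ ·) with hL
  have hmem : ∀ x ∈ L, x ∈ s ∧ ¬ Even x := by simp [hL]
  have hsorted : L.Pairwise (· ≤ ·) := Multiset.pairwise_sort _ _
  have hcount : s.count a = L.count a := by
    rw [← Multiset.coe_count, hL, Multiset.sort_eq, Multiset.count_filter_of_pos (p := fun x => ¬ Even x) ha]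
  have hsort : ((a ::ₘ s.map (· + 2)).filter (fun x => ¬ Even x)).sort (· ≤ ·) =
      a :: L.map (· + 2) := by
    rw [Multiset.filter_cons_of_pos (p := fun x => ¬ Even x) _ ha, Multiset.filter_map, Multiset.sort_cons]
    · rw [Multiset.map_sort (r' := (· ≤ ·)) _ _ _ (by simp)]
      simp [Nat.odd_add]
    · simp only [Multiset.mem_map, Multiset.mem_filter]
      rintro _ ⟨x, ⟨hx, -⟩, rfl⟩
      exact (hs x hx).trans (Nat.le_add_right _ _)
  rw [hsort, gapCond_cons, gapCond_map_add, hcount, ← add_two_le_getElem_one_iff_count_le_one ha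
    hsorted (fun x hx => (hmem x hx).2) (fun x hx => hs x (hmem x hx).1),
    and_comm, List.length_map]
  refine and_congr_right fun _ => forall_congr' fun h => ?_
  rw [getElem!_pos _ _ (by simpa using h), getElem!_pos L _ h]
  simp
  omega

theorem isP2k1Parts_cons_map_add_two {k m n : ℕ} {s : Multiset ℕ}
    (hs : IsP2k1Parts k 2 m n s) :
    IsP2k1Parts k 2 (m + 1) (n + 2 * m + 2 * k + 1) ((2 * k + 1) ::ₘ s.map (· + 2)) ∧
      ¬ IsP2k1Parts k 1 (m + 1) (n + 2 * m + 2 * k + 1) ((2 * k + 1) ::ₘ s.map (· + 2)) := by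
  obtain ⟨hsum, hcard, hle, hcount, heven, hgap⟩ := hs
  have hodd : ¬ Even (2 * k + 1) := by simp
  refine ⟨⟨?_, by simp [hcard], ?_, ?_, ?_, ?_⟩, fun h => ?_⟩
  · simp [Multiset.sum_map_add, hsum, hcard]
    omega
  · simp only [Multiset.mem_cons, Multiset.mem_map]
    rintro _ (rfl | ⟨x, hx, rfl⟩)
    · exact le_rfl
    · have := hle x hx
      omega
  · rw [Multiset.count_cons_self, Multiset.count_eq_zero.2]
    simp only [Multiset.mem_map, not_exists, not_and]
    intro x hx h
    have := hle x hx
    omega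
  · simp only [Multiset.mem_cons, Multiset.mem_map]
    rintro _ (rfl | ⟨x, hx, rfl⟩) h
    · exact absurd h hodd
    · have := heven x hx (by simpa [Nat.even_add] using h)
      omega
  · exact (gapCond_cons_map_add_two hodd hle).2 ⟨hgap, hcount⟩
  · simpa using h.2.2.2.1

theorem exists_isP2k1Parts_of_not {k m n : ℕ} {t : Multiset ℕ}
    (ht : IsP2k1Parts k 2 (m + 1) (n + 2 * m + 2 * k + 1) t)
    (ht' : ¬ IsP2k1Parts k 1 (m + 1) (n + 2 * m + 2 * k + 1) t) :
    ∃ s, IsP2k1Parts k 2 m n s ∧ (2 * k + 1) ::ₘ s.map (· + 2) = t := by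
  obtain ⟨hsum, hcard, hle, hcount, heven, hgap⟩ := ht
  have hodd : ¬ Even (2 * k + 1) := by simp
  have hcount' : t.count (2 * k + 1) ≠ 0 := fun h =>
    ht' ⟨hsum, hcard, hle, h.le, heven, hgap⟩
  obtain ⟨u, rfl⟩ := Multiset.exists_cons_of_mem (Multiset.count_ne_zero.1 hcount')
  rw [Multiset.count_cons_self] at hcount
  have hu : 2 * k + 1 ∉ u := Multiset.count_eq_zero.1 (by omega)
  have hcard' : Multiset.card u = m := by simpa using hcard
  have hule : ∀ x ∈ u, 2 * k + 3 ≤ x := by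
    intro x hx
    have h₁ := hle x (Multiset.mem_cons_of_mem hx)
    have h₂ : x ≠ 2 * k + 1 := fun h => hu (h ▸ hx)
    have h₃ : 0 < Multiset.card u := Multiset.card_pos_iff_exists_mem.2 ⟨x, hx⟩
    have h₄ := heven x (Multiset.mem_cons_of_mem hx)
    rcases Nat.even_or_odd x with h | h
    · have := h₄ h
      omega
    · obtain ⟨c, rfl⟩ := h
      omega
  obtain ⟨s, rfl⟩ : ∃ s : Multiset ℕ, s.map (· + 2) = u := by
    refine ⟨u.map (· - 2), ?_⟩
    rw [Multiset.map_map]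
    refine (Multiset.map_congr rfl fun x hx => ?_).trans (Multiset.map_id u)
    have := hule x hx
    simp
    omega
  have hsle : ∀ x ∈ s, 2 * k + 1 ≤ x := fun x hx => by
    have := hule _ (Multiset.mem_map_of_mem _ hx)
    omega
  rw [Multiset.card_map] at hcard'
  rw [gapCond_cons_map_add_two hodd hsle] at hgap
  refine ⟨s, ⟨?_, hcard', hsle, hgap.2, fun x hx h => ?_, hgap.1⟩, rfl⟩
  · simp [Multiset.sum_map_add, hcard'] at hsum
    omega
  · have := heven (x + 2) (Multiset.mem_cons_of_mem (Multiset.mem_map_of_mem _ hx))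
      (by simpa [Nat.even_add] using h)
    omega

/-- For `k ≥ 1`, `m ≥ 1` and `n ≥ 2m + 2k - 1`,
`p^{2k+1}_{2,2}(m,n) - p^{2k+1}_{2,1}(m,n) = p^{2k+1}_{2,2}(m-1, n - 2m - 2k + 1)`. -/
theorem p2k1_recursion_diff (k m n : ℕ) (hk : 1 ≤ k) (hm : 1 ≤ m)
    (hn : 2 * m + 2 * k - 1 ≤ n) :
    p2k1 k 2 m n - p2k1 k 1 m n = p2k1 k 2 (m - 1) (n + 1 - 2 * m - 2 * k) := by
  obtain ⟨m, rfl⟩ := Nat.exists_eq_add_of_le' hm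
  obtain ⟨n, rfl⟩ : ∃ n', n = n' + 2 * m + 2 * k + 1 := ⟨n - (2 * m + 2 * k + 1), by omega⟩
  rw [show n + 2 * m + 2 * k + 1 + 1 - 2 * (m + 1) - 2 * k = n by omega, Nat.add_sub_cancel]
  simp only [p2k1_eq_ncard]
  have hsub : {s | IsP2k1Parts k 1 (m + 1) (n + 2 * m + 2 * k + 1) s} ⊆
      {s | IsP2k1Parts k 2 (m + 1) (n + 2 * m + 2 * k + 1) s} :=
    fun s ⟨h₁, h₂, h₃, h₄, h₅⟩ => ⟨h₁, h₂, h₃, h₄.trans (by simp), h₅⟩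
  rw [← Set.ncard_sdiff hsub (finite_setOf_isP2k1Parts _ _ _ _)]
  symm
  refine Set.ncard_congr (fun s _ => (2 * k + 1) ::ₘ s.map (· + 2))
    (fun s hs => isP2k1Parts_cons_map_add_two hs) (fun s t _ _ h => ?_)
    (fun t ht => ?_)
  · exact Multiset.map_injective (add_left_injective 2) ((Multiset.cons_inj_right _).1 h)
  · obtain ⟨s, hs, hst⟩ := exists_isP2k1Parts_of_not ht.1 ht.2
    exact ⟨s, hs, hst⟩
end
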